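/- (Boas-type inequality, one-dimensional case.) Let λ > −1/2, σ > 0, m ∈ ℕ and 1 ≤ p ≤ ∞. There is a constant C, depending only on λ and m, such that for every entire function f on ℂ of exponential type at most σ with ‖f‖_{L^p(ℝ,dμ)} < ∞ and all δ, t with 0 < δ ≤ t ≤ 1/(2σ), one has δ^{−2m} ‖**Δ_δ^m f‖_{L^p(ℝ,dμ)} ≤ C t^{−2m} ‖**Δ_t^m f‖_{L^p(ℝ,dμ)}. -/

import Mathlib

open MeasureTheory Real
open scoped NNReal ENNReal

noncomputable section

namespace Dunkl1DStmt15

/-- `b_λ = (2^λ Γ(λ+1))⁻¹`. -/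
def blam (lam : ℝ) : ℝ := ((2 : ℝ) ^ lam * Real.Gamma (lam + 1))⁻¹

/-- `c_λ = Γ(λ+1)/(√π Γ(λ+1/2))`. -/
def clam (lam : ℝ) : ℝ := Real.Gamma (lam + 1) / (Real.sqrt Real.pi * Real.Gamma (lam + 1/2))

/-- The measure `dμ(x) = (b_λ/2)|x|^{2λ+1} dx` on `ℝ`. -/
def μw (lam : ℝ) : Measure ℝ :=
  volume.withDensity fun x => ENNReal.ofReal (blam lam / 2 * |x| ^ (2 * lam + 1))

/-- The measure `dν_λ(t) = b_λ t^{2λ+1} dt` on `(0,∞)`. -/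
def νw (lam : ℝ) : Measure ℝ :=
  (volume.restrict (Set.Ioi 0)).withDensity fun t => ENNReal.ofReal (blam lam * t ^ (2 * lam + 1))

/-- The one-dimensional Dunkl-type generalized translation operator
`T^t f(x) = (c_λ/2) ∫_0^π [f(A)(1+B) + f(−A)(1−B)] sin^{2λ}φ dφ`,
`A = √(x² + t² − 2xt cos φ)`, `B = (x − t cos φ)/A` (with `B = 0` when `A = 0`, which is Lean's
division convention). -/
def T (lam t : ℝ) (f : ℝ → ℂ) (x : ℝ) : ℂ :=
  ((clam lam / 2 : ℝ) : ℂ) *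
    ∫ φ in Set.Ioo (0 : ℝ) Real.pi,
      ((f (Real.sqrt (x ^ 2 + t ^ 2 - 2 * x * t * Real.cos φ)) *
          (1 + (((x - t * Real.cos φ) /
            Real.sqrt (x ^ 2 + t ^ 2 - 2 * x * t * Real.cos φ) : ℝ) : ℂ)) +
        f (-Real.sqrt (x ^ 2 + t ^ 2 - 2 * x * t * Real.cos φ)) *
          (1 - (((x - t * Real.cos φ) /
            Real.sqrt (x ^ 2 + t ^ 2 - 2 * x * t * Real.cos φ) : ℝ) : ℂ))) *
        ((Real.sin φ ^ (2 * lam) : ℝ) : ℂ))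


/-- The symmetric difference
`**Δ_t^m f = C(2m,m)⁻¹ ∑_{s=−m}^m (−1)^s C(2m, m−s) T^{st} f`. -/
def symmDiff (lam : ℝ) (m : ℕ) (t : ℝ) (F : ℝ → ℂ) (x : ℝ) : ℂ :=
  ((Nat.choose (2 * m) m : ℂ))⁻¹ *
    ∑ s ∈ Finset.Icc (-(m : ℤ)) (m : ℤ),
      (-1 : ℂ) ^ s * (Nat.choose (2 * m) ((m : ℤ) - s).toNat : ℂ) * T lam ((s : ℝ) * t) F x

/-- `f` is an entire function on `ℂ` of exponential type at most `σ`. -/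
def IsExpType (σ : ℝ) (f : ℂ → ℂ) : Prop :=
  AnalyticOnNhd ℂ f Set.univ ∧
    ∀ ε > (0 : ℝ), ∃ c : ℝ, ∀ z : ℂ, ‖f z‖ ≤ c * Real.exp ((σ + ε) * ‖z‖)

/-- Dunkl weights of monomials. -/
def th (lam : ℝ) (n : ℕ) : ℝ := if Even n then (n : ℝ) else n + 2 * lam + 1

/-- Dunkl factorials. -/
def dd (lam : ℝ) : ℕ → ℝ
  | 0 => 1
  | n + 1 => dd lam n * th lam (n + 1)

lemma th_ge {lam : ℝ} (h : -(1/2 : ℝ) < lam) (n : ℕ) : (n : ℝ) ≤ th lam n := by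
  unfold th; split_ifs <;> linarith

lemma th_le {lam : ℝ} (h : -(1/2 : ℝ) < lam) (n : ℕ) :
    th lam (n + 1) ≤ (n + 1 : ℝ) * (2 * lam + 2) := by
  have hn : (0 : ℝ) ≤ n := n.cast_nonneg
  unfold th; push_cast; split_ifs <;> nlinarith

lemma dd_ge {lam : ℝ} (h : -(1/2 : ℝ) < lam) (n : ℕ) : (n.factorial : ℝ) ≤ dd lam n := by
  induction n with
  | zero => simp [dd]
  | succ n ih =>
    rw [Nat.factorial_succ, dd, mul_comm]; push_cast
    have := th_ge h (n + 1)
    push_cast at this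
    have : (0:ℝ) ≤ dd lam n := le_trans (by positivity) ih
    gcongr

lemma dd_pos {lam : ℝ} (h : -(1/2 : ℝ) < lam) (n : ℕ) : 0 < dd lam n :=
  lt_of_lt_of_le (by positivity) (dd_ge h n)

lemma dd_le {lam : ℝ} (h : -(1/2 : ℝ) < lam) (n : ℕ) :
    dd lam n ≤ n.factorial * (2 * lam + 2) ^ n := by
  induction n with
  | zero => simp [dd]
  | succ n ih =>
    rw [Nat.factorial_succ, dd, pow_succ]; push_cast
    have h1 := th_le h n
    have h2 : 0 ≤ th lam (n + 1) := le_trans (by positivity) (th_ge h (n + 1))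
    have h3 : 0 < 2 * lam + 2 := by linarith
    calc _ ≤ (n.factorial * (2 * lam + 2) ^ n) * ((n + 1 : ℝ) * (2 * lam + 2)) := by gcongr
      _ = _ := by ring

lemma dd_odd {lam : ℝ} (n : ℕ) : dd lam (2 * n + 1) = dd lam (2 * n) * (2 * n + 2 * lam + 2) := by
  rw [dd, th, if_neg (by simp)]; push_cast; ring

lemma dd_even {lam : ℝ} (n : ℕ) :
    dd lam (2 * (n + 1)) = dd lam (2 * n + 1) * (2 * n + 2) := by
  rw [show 2 * (n + 1) = (2 * n + 1) + 1 by ring, dd, th, if_pos (by simp [parity_simps])]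
  push_cast; ring

/-- the angular weight -/
def ww (lam φ : ℝ) : ℝ := Real.sin φ ^ (2 * lam)

lemma ww_int {lam : ℝ} (h : -(1/2 : ℝ) < lam) :
    IntegrableOn (ww lam) (Set.Ioo 0 π) := by
  have h1 : IntegrableOn (fun φ : ℝ => φ ^ (2 * lam)) (Set.Ioo 0 π) :=
    ((intervalIntegrable_iff_integrableOn_Ioo_of_le pi_pos.le).1
      (intervalIntegral.intervalIntegrable_rpow' (by linarith)))
  have h2 : IntegrableOn (fun φ : ℝ => (π - φ) ^ (2 * lam)) (Set.Ioo 0 π) := by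
    have := (intervalIntegral.intervalIntegrable_rpow' (a := π) (b := 0) (r := 2 * lam)
      (by linarith)).comp_sub_left π
    simp only [sub_self, sub_zero] at this
    exact (intervalIntegrable_iff_integrableOn_Ioo_of_le pi_pos.le).1 this
  have h3 : IntegrableOn (fun φ : ℝ => (2 / π) ^ (2 * lam) * (φ ^ (2 * lam) + (π - φ) ^ (2 * lam)) + 1)
      (Set.Ioo 0 π) := ((h1.add h2).const_mul _).add (integrableOn_const (by simp))
  refine Integrable.mono' h3 ?_ ?_
  · exact (Real.measurable_sin.pow_const _).aestronglyMeasurable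
  · filter_upwards [ae_restrict_mem measurableSet_Ioo] with φ hφ
    have hs : 0 < Real.sin φ := Real.sin_pos_of_mem_Ioo hφ
    have a1 : 0 ≤ φ ^ (2 * lam) := rpow_nonneg hφ.1.le _
    have a2 : 0 ≤ (π - φ) ^ (2 * lam) := rpow_nonneg (by linarith [hφ.2]) _
    have a3 : 0 ≤ (2 / π) ^ (2 * lam) := rpow_nonneg (by positivity) _
    rw [ww, Real.norm_of_nonneg (rpow_nonneg hs.le _)]
    rcases le_or_gt 0 lam with hl | hl
    · have : Real.sin φ ^ (2 * lam) ≤ 1 := rpow_le_one hs.le (Real.sin_le_one _) (by linarith)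
      have := mul_nonneg a3 (add_nonneg a1 a2)
      linarith
    · rw [mul_add]
      have b1 := mul_nonneg a3 a1
      have b2 := mul_nonneg a3 a2
      rcases le_total φ (π / 2) with h4 | h4
      · have := Real.mul_le_sin hφ.1.le h4
        have h5 := rpow_le_rpow_of_nonpos (z := 2 * lam) (by have := hφ.1; positivity) this (by linarith)
        rw [mul_rpow (by positivity) hφ.1.le] at h5
        linarith
      · have := Real.mul_le_sin (x := π - φ) (by linarith [hφ.2]) (by linarith)
        rw [Real.sin_pi_sub] at this
        have h6 : 0 < π - φ := by linarith [hφ.2]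
        have h5 := rpow_le_rpow_of_nonpos (z := 2 * lam) (by positivity) this (by linarith)
        rw [mul_rpow (by positivity) h6.le] at h5
        linarith

lemma cont_ww_int {lam : ℝ} (h : -(1/2 : ℝ) < lam) {q : ℝ → ℝ} (hq : Continuous q) :
    IntegrableOn (fun φ => q φ * ww lam φ) (Set.Ioo 0 π) := by
  obtain ⟨C, hC⟩ := (isCompact_Icc (a := (0:ℝ)) (b := π)).exists_bound_of_continuousOn hq.continuousOn
  refine (ww_int h).bdd_mul (c := C) hq.aestronglyMeasurable ?_
  filter_upwards [ae_restrict_mem measurableSet_Ioo] with φ hφ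
  exact hC φ ⟨hφ.1.le, hφ.2.le⟩

lemma parts {lam : ℝ} (h : -(1/2 : ℝ) < lam) (q q' : ℝ → ℝ) (hq : ∀ φ, HasDerivAt q (q' φ) φ)
    (hq' : Continuous q') :
    ∫ φ in Set.Ioo 0 π, ((2 * lam + 1) * Real.cos φ * q φ + Real.sin φ * q' φ) * ww lam φ = 0 := by
  have hqc : Continuous q := continuous_iff_continuousAt.2 fun x => (hq x).continuousAt
  have h1 := intervalIntegral.integral_eq_sub_of_hasDerivAt_of_le (a := 0) (b := π)
    (f := fun φ => Real.sin φ ^ (2 * lam + 1) * q φ)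
    (f' := fun φ => ((2 * lam + 1) * Real.cos φ * q φ + Real.sin φ * q' φ) * ww lam φ)
    pi_pos.le ?_ ?_ ?_
  · rw [intervalIntegral.integral_of_le pi_pos.le, integral_Ioc_eq_integral_Ioo] at h1
    rw [h1]; simp [zero_rpow (show 2 * lam + 1 ≠ 0 by linarith)]
  · refine Continuous.continuousOn (Continuous.mul ?_ hqc)
    exact Real.continuous_sin.rpow_const (fun x => Or.inr (by linarith))
  · intro φ hφ
    have hs : 0 < Real.sin φ := Real.sin_pos_of_mem_Ioo hφ
    have := ((Real.hasDerivAt_sin φ).rpow_const (p := 2 * lam + 1) (Or.inl hs.ne')).mul (hq φ)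
    refine this.congr_deriv ?_
    rw [ww, add_sub_cancel_right, rpow_add_one hs.ne']; ring
  · rw [intervalIntegrable_iff_integrableOn_Ioo_of_le pi_pos.le]
    exact cont_ww_int h (by fun_prop)

lemma hasDeriv_int {lam : ℝ} (h : -(1/2 : ℝ) < lam) (g g' : ℝ → ℝ → ℝ)
    (hg : ∀ x φ, HasDerivAt (fun y => g y φ) (g' x φ) x)
    (hc : ∀ x, Continuous (g x)) (hg' : Continuous (fun p : ℝ × ℝ => g' p.1 p.2)) (x : ℝ) :
    HasDerivAt (fun y => ∫ φ in Set.Ioo 0 π, g y φ * ww lam φ)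
      (∫ φ in Set.Ioo 0 π, g' x φ * ww lam φ) x := by
  obtain ⟨C, hC⟩ := ((isCompact_closedBall x 1).prod (isCompact_Icc (a := (0:ℝ)) (b := π))).exists_bound_of_continuousOn hg'.continuousOn
  refine (hasDerivAt_integral_of_dominated_loc_of_deriv_le (s := Metric.ball x 1)
    (F := fun y φ => g y φ * ww lam φ) (F' := fun y φ => g' y φ * ww lam φ)
    (bound := fun φ => C * ‖ww lam φ‖) (Metric.ball_mem_nhds x one_pos) ?_ ?_ ?_ ?_ ?_ ?_).2
  · exact Filter.Eventually.of_forall fun y => (cont_ww_int h (hc y)).aestronglyMeasurable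
  · exact cont_ww_int h (hc x)
  · exact (cont_ww_int h (q := g' x) (by fun_prop)).aestronglyMeasurable
  · filter_upwards [ae_restrict_mem measurableSet_Ioo] with φ hφ y hy
    rw [norm_mul]
    gcongr
    exact hC (y, φ) ⟨Metric.ball_subset_closedBall hy, hφ.1.le, hφ.2.le⟩
  · exact (ww_int h).norm.const_mul C
  · exact Filter.Eventually.of_forall fun φ y _ => (hg y φ).mul_const _

/-- total mass -/
def kap (lam : ℝ) : ℝ := ∫ φ in Set.Ioo 0 π, ww lam φ

lemma kap_pos {lam : ℝ} (h : -(1/2 : ℝ) < lam) : 0 < kap lam := by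
  unfold kap
  rw [setIntegral_pos_iff_support_of_nonneg_ae]
  · have : Set.Ioo 0 π ⊆ Function.support (ww lam) ∩ Set.Ioo 0 π := by
      intro φ hφ
      refine ⟨?_, hφ⟩
      have hs : 0 < Real.sin φ := Real.sin_pos_of_mem_Ioo hφ
      exact (rpow_pos_of_pos hs _).ne'
    refine lt_of_lt_of_le ?_ (measure_mono this)
    simp [pi_pos]
  · filter_upwards [ae_restrict_mem measurableSet_Ioo] with φ hφ
    exact rpow_nonneg (Real.sin_pos_of_mem_Ioo hφ).le _
  · exact ww_int h

/-- squared distance -/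
def A2 (x t φ : ℝ) : ℝ := x ^ 2 + t ^ 2 - 2 * x * t * Real.cos φ

def Ue (lam t : ℝ) (n : ℕ) (x : ℝ) : ℝ :=
  ∑ p ∈ Finset.HasAntidiagonal.antidiagonal n, t ^ (2 * p.1) / dd lam (2 * p.1) * (x ^ (2 * p.2) / dd lam (2 * p.2))
def Uo (lam t : ℝ) (n : ℕ) (x : ℝ) : ℝ :=
  ∑ p ∈ Finset.HasAntidiagonal.antidiagonal n,
    t ^ (2 * p.1) / dd lam (2 * p.1) * (x ^ (2 * p.2 + 1) / dd lam (2 * p.2 + 1))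

lemma ode_zero {κ : ℝ} (hκ : 0 < κ) (D D' : ℝ → ℝ) (hD : ∀ x, HasDerivAt D (D' x) x)
    (he : ∀ x, x * D' x + κ * D x = 0) : ∀ x, 0 ≤ x → D x = 0 := by
  have hc : Continuous D := continuous_iff_continuousAt.2 fun x => (hD x).continuousAt
  have h0 : D 0 = 0 := by have := he 0; simpa [hκ.ne'] using this
  intro x hx
  rcases hx.eq_or_lt with rfl | hx
  · exact h0
  have key : (fun y : ℝ => y ^ κ * D y) x = (fun y : ℝ => y ^ κ * D y) 0 := by
    have h1 := intervalIntegral.integral_eq_sub_of_hasDerivAt_of_le (a := 0) (b := x)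
      (f := fun y : ℝ => y ^ κ * D y) (f' := fun _ => 0) hx.le ?_ ?_ (by simp)
    · simp only [intervalIntegral.integral_zero] at h1
      simp only
      linarith
    · exact (Continuous.mul (continuous_id.rpow_const (fun _ => Or.inr hκ.le)) hc).continuousOn
    · intro y hy
      have hy0 := hy.1
      have := ((Real.hasDerivAt_rpow_const (p := κ) (Or.inl hy0.ne')).mul (hD y))
      refine this.congr_deriv ?_
      rw [rpow_sub_one hy0.ne']
      field_simp
      linear_combination y ^ κ * he y
  simp only [h0, mul_zero] at key
  exact (mul_eq_zero.1 key).resolve_left (rpow_pos_of_pos hx _).ne'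

lemma ode_zero' {κ : ℝ} (hκ : 0 < κ) (D D' : ℝ → ℝ) (hD : ∀ x, HasDerivAt D (D' x) x)
    (he : ∀ x, x * D' x + κ * D x = 0) : ∀ x, D x = 0 := by
  intro x
  rcases le_total 0 x with hx | hx
  · exact ode_zero hκ D D' hD he x hx
  · have := ode_zero hκ (fun y => D (-y)) (fun y => -D' (-y)) ?_ ?_ (-x) (by linarith)
    · simpa using this
    · intro y
      have h1 := (hD (-y)).comp y (hasDerivAt_neg y)
      simpa [Function.comp_def] using h1
    · intro y
      have := he (-y)
      linarith

lemma Ue_deriv {lam : ℝ} (h : -(1/2 : ℝ) < lam) (t : ℝ) (n : ℕ) (x : ℝ) :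
    HasDerivAt (Ue lam t (n + 1)) (Uo lam t n x) x := by
  have h0 : Ue lam t (n + 1) = fun x => t ^ (2 * (n + 1)) / dd lam (2 * (n + 1)) * (x ^ 0 / dd lam 0) +
      ∑ p ∈ Finset.HasAntidiagonal.antidiagonal n,
        t ^ (2 * p.1) / dd lam (2 * p.1) * (x ^ (2 * (p.2 + 1)) / dd lam (2 * (p.2 + 1))) := by
    funext x
    unfold Ue
    rw [Finset.Nat.sum_antidiagonal_succ']
    simp
  rw [h0]
  unfold Uo
  simp only [pow_zero]
  refine (HasDerivAt.fun_sum fun p _ => ?_).const_add _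
  refine HasDerivAt.const_mul _ ?_
  have := (hasDerivAt_pow (2 * (p.2 + 1)) x).div_const (dd lam (2 * (p.2 + 1)))
  refine this.congr_deriv ?_
  rw [dd_even]
  have h1 := (dd_pos h (2 * p.2 + 1)).ne'
  have h2 : (2 * p.2 + 2 : ℝ) ≠ 0 := by positivity
  rw [show 2 * (p.2 + 1) - 1 = 2 * p.2 + 1 by omega]
  push_cast
  field_simp

lemma Uo_deriv {lam : ℝ} (h : -(1/2 : ℝ) < lam) (t : ℝ) (n : ℕ) (x : ℝ) :
    ∃ D, HasDerivAt (Uo lam t n) D x ∧ x * D + (2 * lam + 1) * Uo lam t n x = x * Ue lam t n x := by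
  refine ⟨∑ p ∈ Finset.HasAntidiagonal.antidiagonal n,
    t ^ (2 * p.1) / dd lam (2 * p.1) * ((2 * p.2 + 1 : ℕ) * x ^ (2 * p.2) / dd lam (2 * p.2 + 1)), ?_, ?_⟩
  · unfold Uo
    refine HasDerivAt.fun_sum fun p _ => HasDerivAt.const_mul _ ?_
    exact (hasDerivAt_pow (2 * p.2 + 1) x).div_const (dd lam (2 * p.2 + 1))
  · unfold Uo Ue
    rw [Finset.mul_sum, Finset.mul_sum, Finset.mul_sum, ← Finset.sum_add_distrib]
    refine Finset.sum_congr rfl fun p _ => ?_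
    rw [dd_odd]
    have h1 := (dd_pos h (2 * p.2)).ne'
    have h2 : (2 * p.2 + 2 * lam + 2 : ℝ) ≠ 0 := by
      have : (0:ℝ) ≤ p.2 := p.2.cast_nonneg
      linarith
    have h3 := (dd_pos h (2 * p.1)).ne'
    push_cast
    obtain ⟨E, hE⟩ : ∃ E : ℝ, E = 2 * p.2 + 2 * lam + 2 := ⟨_, rfl⟩
    rw [← hE] at h2 ⊢
    field_simp
    rw [hE]
    ring

lemma Ue_zero {lam : ℝ} (t : ℝ) (n : ℕ) :
    Ue lam t n 0 = t ^ (2 * n) / dd lam (2 * n) := by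
  unfold Ue
  rw [Finset.sum_eq_single (n, 0)]
  · simp [dd]
  · rintro ⟨a, b⟩ hab hne
    have : b ≠ 0 := by
      rintro rfl
      simp at hab
      exact hne (by simp [hab])
    simp [this]
  · simp

def Iint (lam t : ℝ) (n : ℕ) (x : ℝ) : ℝ := ∫ φ in Set.Ioo 0 π, A2 x t φ ^ n * ww lam φ
def Jint (lam t : ℝ) (n : ℕ) (x : ℝ) : ℝ :=
  ∫ φ in Set.Ioo 0 π, ((x - t * Real.cos φ) * A2 x t φ ^ n) * ww lam φ

lemma A2_deriv (x t φ : ℝ) :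
    HasDerivAt (fun y => A2 y t φ) (2 * (x - t * Real.cos φ)) x := by
  unfold A2
  have := ((hasDerivAt_pow 2 x).add_const (t ^ 2)).sub
    (((hasDerivAt_id x).const_mul 2).mul_const t |>.mul_const (Real.cos φ))
  refine this.congr_deriv ?_
  simp; ring

lemma A2_cont : Continuous (fun p : ℝ × ℝ × ℝ => A2 p.1 p.2.1 p.2.2) := by
  unfold A2; fun_prop

lemma Iint_deriv {lam : ℝ} (h : -(1/2 : ℝ) < lam) (t : ℝ) (n : ℕ) (x : ℝ) :
    HasDerivAt (Iint lam t (n + 1)) ((2 * n + 2) * Jint lam t n x) x := by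
  have := hasDeriv_int h (fun x φ => A2 x t φ ^ (n + 1))
    (fun x φ => (2 * n + 2) * ((x - t * Real.cos φ) * A2 x t φ ^ n)) ?_ ?_ ?_ x
  · refine this.congr_deriv ?_
    unfold Jint
    rw [← integral_const_mul]
    congr 1; funext φ; ring
  · intro x φ
    refine ((A2_deriv x t φ).fun_pow (n + 1)).congr_deriv ?_
    simp; ring
  · intro x; unfold A2; fun_prop
  · unfold A2; fun_prop

lemma Jint_deriv {lam : ℝ} (h : -(1/2 : ℝ) < lam) (t : ℝ) (n : ℕ) (x : ℝ) :
    ∃ D, HasDerivAt (Jint lam t n) D x ∧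
      x * D + (2 * lam + 1) * Jint lam t n x = (2 * n + 2 * lam + 2) * (x * Iint lam t n x) := by
  set G : ℝ → ℝ → ℝ := fun x φ => A2 x t φ ^ n +
      (x - t * Real.cos φ) * (n * A2 x t φ ^ (n - 1) * (2 * (x - t * Real.cos φ))) with hG
  refine ⟨∫ φ in Set.Ioo 0 π, G x φ * ww lam φ, ?_, ?_⟩
  · refine hasDeriv_int h (fun x φ => (x - t * Real.cos φ) * A2 x t φ ^ n) G ?_ ?_ ?_ x
    · intro x φ
      refine (((hasDerivAt_id x).sub_const _).mul ((A2_deriv x t φ).fun_pow n)).congr_deriv ?_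
      simp [hG]
    · intro x; unfold A2; fun_prop
    · simp only [hG]; unfold A2; fun_prop
  · have hp := parts h (fun φ => A2 x t φ ^ n)
      (fun φ => n * A2 x t φ ^ (n - 1) * (2 * x * t * Real.sin φ)) ?_ ?_
    · have i1 : IntegrableOn (fun φ => x * (G x φ * ww lam φ)) (Set.Ioo 0 π) :=
        (cont_ww_int h (by simp only [hG]; unfold A2; fun_prop)).const_mul x
      have i2 : IntegrableOn (fun φ => (2 * lam + 1) * (((x - t * Real.cos φ) * A2 x t φ ^ n) * ww lam φ)) (Set.Ioo 0 π) :=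
        (cont_ww_int h (by unfold A2; fun_prop)).const_mul _
      have i3 : IntegrableOn (fun φ => (2 * n + 2 * lam + 2) * (x * (A2 x t φ ^ n * ww lam φ))) (Set.Ioo 0 π) :=
        ((cont_ww_int h (by unfold A2; fun_prop)).const_mul _).const_mul _
      unfold Jint Iint
      rw [← sub_eq_zero, ← integral_const_mul, ← integral_const_mul, ← integral_const_mul,
        ← integral_const_mul, ← integral_add i1 i2]
      refine (integral_sub (i1.add i2) i3).symm.trans ?_
      have hp2 := congrArg (fun z => -t * z) hp
      simp only [mul_zero, ← integral_const_mul] at hp2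
      refine Eq.trans ?_ hp2
      congr 1; funext φ
      simp only [hG, Pi.add_apply]
      have e1 : (n : ℝ) * A2 x t φ ^ (n - 1) * A2 x t φ = n * A2 x t φ ^ n := by
        cases n with
        | zero => simp
        | succ n => simp [pow_succ]; ring
      have e2 : A2 x t φ = (x - t * Real.cos φ) ^ 2 + t ^ 2 * Real.sin φ ^ 2 := by
        unfold A2; nlinarith [Real.sin_sq_add_cos_sq φ]
      have e3 : (n : ℝ) * A2 x t φ ^ (n - 1) * ((x - t * Real.cos φ) ^ 2 + t ^ 2 * Real.sin φ ^ 2) = n * A2 x t φ ^ n := by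
        rw [← e2]; exact e1
      linear_combination 2 * x * ww lam φ * e3
    · intro φ
      have : HasDerivAt (fun φ => A2 x t φ) (2 * x * t * Real.sin φ) φ := by
        unfold A2
        have := ((Real.hasDerivAt_cos φ).const_mul (2 * x * t)).const_sub (x ^ 2 + t ^ 2)
        refine this.congr_deriv ?_
        ring
      exact this.fun_pow n
    · unfold A2; fun_prop

lemma IJ {lam : ℝ} (h : -(1/2 : ℝ) < lam) (t : ℝ) (n : ℕ) :
    (∀ x, Iint lam t n x = kap lam * dd lam (2 * n) * Ue lam t n x) ∧
    (∀ x, Jint lam t n x = kap lam * dd lam (2 * n + 1) * Uo lam t n x) := by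
  have step : ∀ n, (∀ x, Iint lam t n x = kap lam * dd lam (2 * n) * Ue lam t n x) →
      (∀ x, Jint lam t n x = kap lam * dd lam (2 * n + 1) * Uo lam t n x) := by
    intro n hn
    choose D1 hD1 hD1' using Jint_deriv h t n
    choose D2 hD2 hD2' using Uo_deriv h t n
    have := ode_zero' (κ := 2 * lam + 1) (by linarith)
      (fun x => Jint lam t n x - kap lam * dd lam (2 * n + 1) * Uo lam t n x)
      (fun x => D1 x - kap lam * dd lam (2 * n + 1) * D2 x)
      (fun x => (hD1 x).sub ((hD2 x).const_mul _)) ?_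
    · intro x; linarith [this x]
    · intro x
      have a := hD1' x
      have b := hD2' x
      rw [hn] at a
      rw [dd_odd]
      linear_combination a - kap lam * (dd lam (2 * n) * (2 * n + 2 * lam + 2)) * b
  induction n with
  | zero =>
    have : ∀ x, Iint lam t 0 x = kap lam * dd lam (2 * 0) * Ue lam t 0 x := by
      intro x; simp [Iint, kap, Ue, dd]
    exact ⟨this, step 0 this⟩
  | succ n ih =>
    have : ∀ x, Iint lam t (n+1) x = kap lam * dd lam (2 * (n+1)) * Ue lam t (n+1) x := by
      have hd : ∀ x, HasDerivAt (fun x => Iint lam t (n+1) x - kap lam * dd lam (2 * (n+1)) * Ue lam t (n+1) x) 0 x := by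
        intro x
        refine ((Iint_deriv h t n x).sub ((Ue_deriv h t n x).const_mul _)).congr_deriv ?_
        rw [ih.2, dd_even]; ring
      intro x
      have := is_const_of_deriv_eq_zero (fun x => (hd x).differentiableAt) (fun x => (hd x).deriv) x 0
      have h0 : Iint lam t (n+1) 0 = kap lam * t ^ (2 * (n + 1)) := by
        simp only [Iint, A2, kap]
        rw [mul_comm (∫ φ in Set.Ioo 0 π, ww lam φ), ← integral_const_mul]
        congr 1; funext φ
        simp [← pow_mul]
      simp only [h0, Ue_zero] at this
      have h1 := (dd_pos h (2 * (n + 1))).ne'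
      rw [sub_eq_iff_eq_add] at this
      rw [this]
      field_simp
      ring
    exact ⟨this, step _ this⟩

/-- Dunkl-Taylor series. -/
def Fb (lam : ℝ) (b : ℕ → ℂ) (x : ℝ) : ℂ := ∑' n, b n * ((x ^ n / dd lam n : ℝ) : ℂ)

/-- shift by `2k` -/
def sh (k : ℕ) (b : ℕ → ℂ) : ℕ → ℂ := fun n => b (n + 2 * k)

/-- geometric growth -/
def Bd (c τ : ℝ) (b : ℕ → ℂ) : Prop := ∀ n, ‖b n‖ ≤ c * τ ^ n

lemma Bd.c_nonneg {c τ : ℝ} {b : ℕ → ℂ} (hb : Bd c τ b) : 0 ≤ c := by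
  have := (norm_nonneg _).trans (hb 0)
  simpa using this

lemma Bd.sh {c τ : ℝ} {b : ℕ → ℂ} (hb : Bd c τ b) (k : ℕ) : Bd (c * τ ^ (2 * k)) τ (sh k b) := by
  intro n
  refine (hb (n + 2 * k)).trans_eq ?_
  rw [pow_add]; ring

lemma xd_le {lam : ℝ} (h : -(1/2 : ℝ) < lam) (x : ℝ) (n : ℕ) :
    ‖((x ^ n / dd lam n : ℝ) : ℂ)‖ ≤ |x| ^ n / n.factorial := by
  rw [Complex.norm_real, norm_div, norm_pow, Real.norm_eq_abs, Real.norm_of_nonneg (dd_pos h n).le]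
  gcongr
  exact dd_ge h n

lemma Fb_term {lam : ℝ} (h : -(1/2 : ℝ) < lam) {c τ : ℝ} (hτ : 0 ≤ τ) {b : ℕ → ℂ} (hb : Bd c τ b)
    (x : ℝ) (n : ℕ) :
    ‖b n * ((x ^ n / dd lam n : ℝ) : ℂ)‖ ≤ c * ((τ * |x|) ^ n / n.factorial) := by
  rw [norm_mul]
  calc _ ≤ (c * τ ^ n) * (|x| ^ n / n.factorial) := by
        gcongr
        · exact (norm_nonneg _).trans (hb n)
        · exact hb n
        · exact xd_le h x n
    _ = _ := by rw [mul_pow]; ring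

lemma Fb_summable {lam : ℝ} (h : -(1/2 : ℝ) < lam) {c τ : ℝ} (hτ : 0 ≤ τ) {b : ℕ → ℂ}
    (hb : Bd c τ b) (x : ℝ) : Summable fun n => b n * ((x ^ n / dd lam n : ℝ) : ℂ) :=
  Summable.of_norm_bounded ((Real.summable_pow_div_factorial _).mul_left c) (Fb_term h hτ hb x)

lemma Fb_bound {lam : ℝ} (h : -(1/2 : ℝ) < lam) {c τ : ℝ} (hτ : 0 ≤ τ) {b : ℕ → ℂ}
    (hb : Bd c τ b) (x : ℝ) : ‖Fb lam b x‖ ≤ c * Real.exp (τ * |x|) := by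
  refine tsum_of_norm_bounded ?_ (Fb_term h hτ hb x)
  rw [Real.exp_eq_exp_ℝ]
  exact (NormedSpace.expSeries_div_hasSum_exp (τ * |x|)).mul_left c

lemma Fb_continuous {lam : ℝ} (h : -(1/2 : ℝ) < lam) {c τ : ℝ} (hτ : 0 ≤ τ) {b : ℕ → ℂ}
    (hb : Bd c τ b) : Continuous (Fb lam b) := by
  rw [continuous_iff_continuousAt]
  intro x
  have : ContinuousOn (Fb lam b) (Metric.ball x 1) := by
    have hu : Summable (fun n : ℕ => c * ((τ * (|x| + 1)) ^ n / n.factorial)) :=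
      (Real.summable_pow_div_factorial _).mul_left c
    have key : ∀ F : ℕ → ℝ → ℂ, (∀ n, ContinuousOn (F n) (Metric.ball x 1)) →
        (∀ n, ∀ y ∈ Metric.ball x 1, ‖F n y‖ ≤ c * ((τ * (|x| + 1)) ^ n / n.factorial)) →
        ContinuousOn (fun y => ∑' n, F n y) (Metric.ball x 1) :=
      fun F h1 h2 => continuousOn_tsum h1 hu h2
    refine key (fun n y => b n * ((y ^ n / dd lam n : ℝ) : ℂ)) ?_ ?_
    · intro n
      exact Continuous.continuousOn (continuous_const.mul
        (Complex.continuous_ofReal.comp ((continuous_pow n).div_const _)))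
    · intro n y hy
      refine (Fb_term h hτ hb y n).trans ?_
      have : |y| ≤ |x| + 1 := by
        have h1 : |y - x| < 1 := by simpa [Real.dist_eq] using hy
        have := abs_sub_abs_le_abs_sub y x
        linarith
      have := hb.c_nonneg
      gcongr
  exact this.continuousAt (Metric.ball_mem_nhds x one_pos)

lemma dsum {G : ℕ × ℕ → ℂ} (hG : Summable G) :
    HasSum (fun j => ∑ p ∈ Finset.HasAntidiagonal.antidiagonal j, G p) (∑' k, ∑' l, G (k, l)) := by
  rw [← hG.tsum_prod]
  have := (Finset.HasAntidiagonal.sigmaAntidiagonalEquivProd.hasSum_iff (f := G)).2 hG.hasSum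
  refine this.sigma fun j => ?_
  have := hasSum_fintype (fun p : Finset.HasAntidiagonal.antidiagonal j => G p)
  rw [Finset.sum_coe_sort] at this
  exact this

/-- the integrand for a monomial -/
def qn (x t : ℝ) (n : ℕ) (φ : ℝ) : ℝ :=
  Real.sqrt (A2 x t φ) ^ n * (1 + (x - t * Real.cos φ) / Real.sqrt (A2 x t φ)) +
  (-Real.sqrt (A2 x t φ)) ^ n * (1 - (x - t * Real.cos φ) / Real.sqrt (A2 x t φ))

lemma A2_eq (x t φ : ℝ) : A2 x t φ = (x - t * Real.cos φ) ^ 2 + t ^ 2 * Real.sin φ ^ 2 := by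
  unfold A2; nlinarith [Real.sin_sq_add_cos_sq φ]

lemma A2_nonneg (x t φ : ℝ) : 0 ≤ A2 x t φ := by rw [A2_eq]; positivity

lemma B_le (x t φ : ℝ) : |(x - t * Real.cos φ) / Real.sqrt (A2 x t φ)| ≤ 1 := by
  rw [abs_div, abs_of_nonneg (Real.sqrt_nonneg _)]
  refine div_le_one_of_le₀ ?_ (Real.sqrt_nonneg _)
  rw [← Real.sqrt_sq_eq_abs]
  apply Real.sqrt_le_sqrt
  rw [A2_eq]; nlinarith [mul_nonneg (sq_nonneg t) (sq_nonneg (Real.sin φ))]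

lemma A_mul_B (x t φ : ℝ) :
    Real.sqrt (A2 x t φ) * ((x - t * Real.cos φ) / Real.sqrt (A2 x t φ)) = x - t * Real.cos φ := by
  by_cases h0 : Real.sqrt (A2 x t φ) = 0
  · rw [h0, zero_mul]
    rw [Real.sqrt_eq_zero (A2_nonneg x t φ), A2_eq] at h0
    have : (x - t * Real.cos φ) ^ 2 = 0 := by
      nlinarith [mul_nonneg (sq_nonneg t) (sq_nonneg (Real.sin φ)), sq_nonneg (x - t * Real.cos φ)]
    exact (pow_eq_zero_iff two_ne_zero |>.1 this).symm
  · field_simp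

lemma sqrtA2_le (x t φ : ℝ) : Real.sqrt (A2 x t φ) ≤ |x| + |t| := by
  rw [← Real.sqrt_sq (by positivity : 0 ≤ |x| + |t|)]
  apply Real.sqrt_le_sqrt
  unfold A2
  have h1 : |x * t * Real.cos φ| ≤ |x| * |t| := by
    rw [abs_mul, abs_mul]
    exact mul_le_of_le_one_right (by positivity) (Real.abs_cos_le_one φ)
  have := neg_abs_le (x * t * Real.cos φ)
  nlinarith [sq_abs x, sq_abs t]

lemma qn_even (x t : ℝ) (j : ℕ) (φ : ℝ) : qn x t (2 * j) φ = 2 * A2 x t φ ^ j := by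
  unfold qn
  rw [pow_mul, pow_mul, neg_sq, Real.sq_sqrt (A2_nonneg x t φ)]; ring

lemma qn_odd (x t : ℝ) (j : ℕ) (φ : ℝ) :
    qn x t (2 * j + 1) φ = 2 * ((x - t * Real.cos φ) * A2 x t φ ^ j) := by
  unfold qn
  rw [pow_succ, pow_succ, pow_mul, pow_mul, neg_sq, Real.sq_sqrt (A2_nonneg x t φ)]
  linear_combination 2 * A2 x t φ ^ j * A_mul_B x t φ

lemma qn_cont (x t : ℝ) (n : ℕ) : Continuous (qn x t n) := by
  rcases Nat.even_or_odd' n with ⟨j, rfl | rfl⟩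
  · rw [funext (qn_even x t j)]; unfold A2; fun_prop
  · rw [funext (qn_odd x t j)]; unfold A2; fun_prop

lemma qn_le (x t : ℝ) (n : ℕ) (φ : ℝ) : |qn x t n φ| ≤ 4 * (|x| + |t|) ^ n := by
  unfold qn
  have hB := abs_le.1 (B_le x t φ)
  have hA : |Real.sqrt (A2 x t φ) ^ n| ≤ (|x| + |t|) ^ n := by
    rw [abs_pow, abs_of_nonneg (Real.sqrt_nonneg _)]
    gcongr; exact sqrtA2_le x t φ
  have hA' : |(-Real.sqrt (A2 x t φ)) ^ n| ≤ (|x| + |t|) ^ n := by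
    rw [abs_pow, abs_neg, ← abs_pow]; exact hA
  set B := (x - t * Real.cos φ) / Real.sqrt (A2 x t φ)
  have h1 : |1 + B| ≤ 2 := abs_le.2 ⟨by linarith, by linarith⟩
  have h2 : |1 - B| ≤ 2 := abs_le.2 ⟨by linarith, by linarith⟩
  refine (abs_add_le _ _).trans ?_
  rw [abs_mul, abs_mul]
  have h0 : 0 ≤ (|x| + |t|) ^ n := by positivity
  have := mul_le_mul hA h1 (abs_nonneg _) h0
  have := mul_le_mul hA' h2 (abs_nonneg _) h0
  linarith

lemma ww_nonneg {lam φ : ℝ} (hφ : φ ∈ Set.Ioo 0 π) : 0 ≤ ww lam φ :=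
  rpow_nonneg (Real.sin_pos_of_mem_Ioo hφ).le _

lemma T_sum1 {lam : ℝ} (h : -(1/2 : ℝ) < lam) {c τ : ℝ} (hτ : 0 ≤ τ) {b : ℕ → ℂ}
    (hb : Bd c τ b) (t x : ℝ) :
    HasSum (fun n => ((clam lam / 2 : ℝ) : ℂ) * (b n *
      (((∫ φ in Set.Ioo 0 π, qn x t n φ * ww lam φ) / dd lam n : ℝ) : ℂ)))
      (T lam t (Fb lam b) x) := by
  unfold T
  refine HasSum.mul_left _ ?_
  set G : ℕ → ℝ → ℂ := fun n φ => b n * ((qn x t n φ * ww lam φ / dd lam n : ℝ) : ℂ) with hG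
  have hIntg : ∀ n, Integrable (G n) (volume.restrict (Set.Ioo 0 π)) := by
    intro n
    exact (((cont_ww_int h (qn_cont x t n)).div_const _).ofReal).const_mul _
  have hle : ∀ n, ∀ φ ∈ Set.Ioo 0 π, ‖G n φ‖ ≤
      c * ((τ * (|x| + |t|)) ^ n / n.factorial) * 4 * ww lam φ := by
    intro n φ hφ
    simp only [hG]
    rw [norm_mul, Complex.norm_real, norm_div, norm_mul, Real.norm_of_nonneg (ww_nonneg hφ),
      Real.norm_of_nonneg (dd_pos h n).le, Real.norm_eq_abs]
    have h0 := ww_nonneg (lam := lam) hφ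
    have h1 : (0:ℝ) < n.factorial := by positivity
    calc _ ≤ (c * τ ^ n) * (4 * (|x| + |t|) ^ n * ww lam φ / n.factorial) := by
          have := dd_pos h n
          have := (norm_nonneg _).trans (hb n)
          gcongr
          · exact hb n
          · exact qn_le x t n φ
          · exact dd_ge h n
      _ = _ := by rw [mul_pow]; ring
  have hs := hasSum_integral_of_summable_integral_norm hIntg ?_
  · have e1 : (fun n => (b n *
      (((∫ φ in Set.Ioo 0 π, qn x t n φ * ww lam φ) / dd lam n : ℝ) : ℂ))) =
        fun n => ∫ φ in Set.Ioo 0 π, G n φ := by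
      funext n
      simp only [hG]
      rw [integral_const_mul, integral_complex_ofReal, integral_div]
    rw [e1]
    refine (congrArg (HasSum fun n => ∫ φ in Set.Ioo 0 π, G n φ) ?_).mpr hs
    · refine setIntegral_congr_fun measurableSet_Ioo fun φ hφ => ?_
      simp only [hG]
      have s1 := (Fb_summable h hτ hb (Real.sqrt (A2 x t φ))).hasSum
      have s2 := (Fb_summable h hτ hb (-Real.sqrt (A2 x t φ))).hasSum
      have := ((s1.mul_right (1 + (((x - t * Real.cos φ) / Real.sqrt (A2 x t φ) : ℝ) : ℂ))).add
        (s2.mul_right (1 - (((x - t * Real.cos φ) / Real.sqrt (A2 x t φ) : ℝ) : ℂ)))).mul_right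
        ((ww lam φ : ℝ) : ℂ)
      refine this.tsum_eq.symm.trans ?_
      refine tsum_congr fun n => ?_
      unfold qn
      push_cast
      ring
  · refine Summable.of_nonneg_of_le (fun n => integral_nonneg fun _ => norm_nonneg _)
      (f := fun n => c * ((τ * (|x| + |t|)) ^ n / n.factorial) * (4 * kap lam)) ?_ ?_
    · intro n
      rw [← mul_assoc, kap, ← integral_const_mul]
      exact setIntegral_mono_on (hIntg n).norm ((ww_int h).const_mul _) measurableSet_Ioo (hle n)
    · exact ((Real.summable_pow_div_factorial _).mul_left c).mul_right _

lemma G_summable {lam : ℝ} (h : -(1/2 : ℝ) < lam) {c τ : ℝ} (hτ : 0 ≤ τ) {b : ℕ → ℂ}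
    (hb : Bd c τ b) (t x : ℝ) :
    Summable (fun p : ℕ × ℕ => ((t ^ (2 * p.1) / dd lam (2 * p.1) : ℝ) : ℂ) *
    (b (p.2 + 2 * p.1) * ((x ^ p.2 / dd lam p.2 : ℝ) : ℂ))) := by
  have s1 := (Real.summable_pow_div_factorial (τ * |t|)).comp_injective
    (i := fun k : ℕ => 2 * k) (fun a b hab => by simpa using hab)
  have s2 := (Real.summable_pow_div_factorial (τ * |x|))
  have := (s1.mul_left c).mul_of_nonneg s2
    (fun k => mul_nonneg hb.c_nonneg (by simp only [Function.comp_apply]; positivity))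
    (fun k => by positivity)
  refine Summable.of_norm_bounded this ?_
  rintro ⟨k, n⟩
  simp only [Function.comp_apply]
  rw [norm_mul]
  refine (mul_le_mul (xd_le h t (2 * k)) (Fb_term h hτ (hb.sh k) x n) (norm_nonneg _) (by positivity)).trans_eq ?_
  rw [mul_pow, mul_pow]; ring

lemma hs_congr {f g : ℕ → ℂ} {a : ℂ} (hfg : ∀ j, f j = g j) (hg : HasSum g a) : HasSum f a := by
  rw [funext hfg]; exact hg

lemma T_sum {lam : ℝ} (h : -(1/2 : ℝ) < lam) {c τ : ℝ} (hτ : 0 ≤ τ) {b : ℕ → ℂ}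
    (hb : Bd c τ b) (t x : ℝ) :
    Summable (fun k => ((t ^ (2 * k) / dd lam (2 * k) : ℝ) : ℂ) * Fb lam (sh k b) x) ∧
    T lam t (Fb lam b) x = ((clam lam * kap lam : ℝ) : ℂ) *
      ∑' k, ((t ^ (2 * k) / dd lam (2 * k) : ℝ) : ℂ) * Fb lam (sh k b) x := by
  have hGs := G_summable h hτ hb t x
  obtain ⟨G, hG⟩ : ∃ G : ℕ × ℕ → ℂ, G = fun p => ((t ^ (2 * p.1) / dd lam (2 * p.1) : ℝ) : ℂ) *
    (b (p.2 + 2 * p.1) * ((x ^ p.2 / dd lam p.2 : ℝ) : ℂ)) := ⟨_, rfl⟩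
  rw [← hG] at hGs
  have hGE : Summable (fun p : ℕ × ℕ => G (p.1, 2 * p.2)) :=
    hGs.comp_injective (i := fun p : ℕ × ℕ => (p.1, 2 * p.2))
      (fun a b hab => by simp at hab; exact Prod.ext hab.1 hab.2)
  have hGO : Summable (fun p : ℕ × ℕ => G (p.1, 2 * p.2 + 1)) :=
    hGs.comp_injective (i := fun p : ℕ × ℕ => (p.1, 2 * p.2 + 1))
      (fun a b hab => by simp at hab; exact Prod.ext hab.1 hab.2)
  have hfib : (fun k => ((t ^ (2 * k) / dd lam (2 * k) : ℝ) : ℂ) * Fb lam (sh k b) x) =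
      fun k => ∑' n, G (k, n) := by
    funext k
    rw [hG]
    exact (tsum_mul_left).symm
  rw [hfib]
  refine ⟨hGs.prod, ?_⟩
  have hsplit : ∑' k, ∑' n, G (k, n) =
      (∑' k, ∑' l, G (k, 2 * l)) + ∑' k, ∑' l, G (k, 2 * l + 1) := by
    rw [← (hGE.prod).tsum_add hGO.prod]
    refine tsum_congr fun k => ?_
    exact (tsum_even_add_odd (f := fun n => G (k, n)) (hGE.prod_factor k) (hGO.prod_factor k)).symm
  have d1 := (dsum hGE).mul_left ((clam lam * kap lam : ℝ) : ℂ)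
  have d2 := (dsum hGO).mul_left ((clam lam * kap lam : ℝ) : ℂ)
  have hT := T_sum1 h hτ hb t x
  refine hT.unique ?_
  rw [hsplit, mul_add]
  refine HasSum.even_add_odd ?_ ?_
  · refine hs_congr (fun j => ?_) d1
    have e1 : ∫ φ in Set.Ioo 0 π, qn x t (2 * j) φ * ww lam φ =
        2 * (kap lam * dd lam (2 * j) * Ue lam t j x) := by
      rw [← (IJ h t j).1 x, Iint, ← integral_const_mul]
      congr 1; funext φ; rw [qn_even]; ring
    have h1 := (dd_pos h (2 * j)).ne'
    have e2 : 2 * (kap lam * dd lam (2 * j) * Ue lam t j x) / dd lam (2 * j) = 2 * kap lam * Ue lam t j x := by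
      field_simp
    rw [e1, e2]
    have e3 : ∑ p ∈ Finset.HasAntidiagonal.antidiagonal j, G (p.1, 2 * p.2) = b (2 * j) * ((Ue lam t j x : ℝ) : ℂ) := by
      unfold Ue
      rw [Complex.ofReal_sum, Finset.mul_sum]
      refine Finset.sum_congr rfl fun p hp => ?_
      rw [Finset.HasAntidiagonal.mem_antidiagonal] at hp
      rw [hG]
      simp only
      rw [show 2 * p.2 + 2 * p.1 = 2 * j by omega]
      push_cast; ring
    rw [e3]; push_cast; ring
  · refine hs_congr (fun j => ?_) d2
    have e1 : ∫ φ in Set.Ioo 0 π, qn x t (2 * j + 1) φ * ww lam φ =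
        2 * (kap lam * dd lam (2 * j + 1) * Uo lam t j x) := by
      rw [← (IJ h t j).2 x, Jint, ← integral_const_mul]
      congr 1; funext φ; rw [qn_odd]; ring
    have h1 := (dd_pos h (2 * j + 1)).ne'
    have e2 : 2 * (kap lam * dd lam (2 * j + 1) * Uo lam t j x) / dd lam (2 * j + 1) = 2 * kap lam * Uo lam t j x := by
      field_simp
    rw [e1, e2]
    have e3 : ∑ p ∈ Finset.HasAntidiagonal.antidiagonal j, G (p.1, 2 * p.2 + 1) = b (2 * j + 1) * ((Uo lam t j x : ℝ) : ℂ) := by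
      unfold Uo
      rw [Complex.ofReal_sum, Finset.mul_sum]
      refine Finset.sum_congr rfl fun p hp => ?_
      rw [Finset.HasAntidiagonal.mem_antidiagonal] at hp
      rw [hG]
      simp only
      rw [show 2 * p.2 + 1 + 2 * p.1 = 2 * j + 1 by omega]
      push_cast; ring
    rw [e3]; push_cast; ring

/-- the angular measure -/
def ρw (lam : ℝ) : Measure ℝ :=
  (volume.restrict (Set.Ioo 0 π)).withDensity fun φ => ENNReal.ofReal (ww lam φ)

lemma ww_meas (lam : ℝ) : Measurable (ww lam) := by
  unfold ww; fun_prop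

lemma ρw_lint (lam : ℝ) (g : ℝ → ℝ≥0∞) :
    ∫⁻ φ, g φ ∂ρw lam = ∫⁻ φ in Set.Ioo 0 π, ENNReal.ofReal (ww lam φ) * g φ := by
  unfold ρw
  rw [lintegral_withDensity_eq_lintegral_mul_non_measurable _ (ww_meas lam).ennreal_ofReal
    (Filter.Eventually.of_forall fun _ => ENNReal.ofReal_lt_top)]
  rfl

lemma ρw_univ {lam : ℝ} (h : -(1/2 : ℝ) < lam) : ρw lam Set.univ = ENNReal.ofReal (kap lam) := by
  have := ρw_lint lam (fun _ => 1)
  rw [lintegral_one] at this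
  rw [this, kap, ofReal_integral_eq_lintegral_ofReal (ww_int h)]
  · simp
  · filter_upwards [ae_restrict_mem measurableSet_Ioo] with φ hφ using ww_nonneg hφ

def f0 (lam : ℝ) (g : ℝ → ℝ≥0∞) (p : ℝ × ℝ) : ℝ≥0∞ :=
  if 0 < p.2 then ENNReal.ofReal (p.2 ^ (2 * lam)) * g (Real.sqrt (p.1 ^ 2 + p.2 ^ 2)) else 0

lemma f0_meas (lam : ℝ) {g : ℝ → ℝ≥0∞} (hg : Measurable g) : Measurable (f0 lam g) := by
  unfold f0
  refine Measurable.ite (measurableSet_lt measurable_const measurable_snd) ?_ measurable_const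
  fun_prop

lemma inv0 (lam : ℝ) {g : ℝ → ℝ≥0∞} (hg : Measurable g) (s : ℝ) :
    ∫⁻ x in Set.Ioi 0, ENNReal.ofReal (x ^ (2 * lam + 1)) * ∫⁻ φ, g (Real.sqrt (A2 x s φ)) ∂ρw lam
      = ∫⁻ p, f0 lam g p := by
  have h1 : ∫⁻ p : ℝ × ℝ, f0 lam g (p - (s, 0)) = ∫⁻ p, f0 lam g p :=
    lintegral_sub_right_eq_self _ _
  have hm : Measurable (fun p : ℝ × ℝ => f0 lam g (p - (s, 0))) :=
    (f0_meas lam hg).comp (measurable_id.sub_const _)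
  rw [← h1, ← lintegral_comp_polarCoord_symm, polarCoord_target, Measure.volume_eq_prod,
    ← Measure.prod_restrict, lintegral_prod]
  · refine setLIntegral_congr_fun measurableSet_Ioi fun r hr => ?_
    have hr : 0 < r := hr
    simp only
    rw [ρw_lint, ← lintegral_const_mul']
    · have e : ∀ θ ∈ Set.Ioo (-π) π, ENNReal.ofReal r • f0 lam g (polarCoord.symm (r, θ) - (s, 0)) =
          (Set.Ioo 0 π).indicator (fun θ => ENNReal.ofReal (r ^ (2 * lam + 1)) *
            (ENNReal.ofReal (ww lam θ) * g (Real.sqrt (A2 r s θ)))) θ := by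
        intro θ hθ
        rw [polarCoord_symm_apply]
        simp only [f0, Prod.mk_sub_mk, sub_zero]
        by_cases h0 : 0 < θ
        · have hθ' : θ ∈ Set.Ioo 0 π := ⟨h0, hθ.2⟩
          have hs := Real.sin_pos_of_mem_Ioo hθ'
          rw [Set.indicator_of_mem hθ', if_pos (by positivity), smul_eq_mul, ← mul_assoc, ← mul_assoc]
          congr 1
          · rw [← ENNReal.ofReal_mul (by positivity), ← ENNReal.ofReal_mul (by positivity)]
            congr 1
            rw [Real.mul_rpow hr.le hs.le, Real.rpow_add hr, Real.rpow_one, ww]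
            ring
          · congr 2
            unfold A2
            nlinarith [Real.sin_sq_add_cos_sq θ]
        · rw [Set.indicator_of_notMem (fun hh => h0 hh.1), if_neg, smul_zero]
          have := Real.sin_nonpos_of_nonpos_of_neg_pi_le (not_lt.1 h0) hθ.1.le
          have := mul_nonpos_of_nonneg_of_nonpos hr.le this
          linarith
      rw [setLIntegral_congr_fun measurableSet_Ioo e, setLIntegral_indicator measurableSet_Ioo]
      congr 2
      ext θ
      simp only [Set.mem_inter_iff, Set.mem_Ioo]
      constructor
      · rintro ⟨a, b⟩; exact ⟨⟨a, b⟩, by linarith [pi_pos], b⟩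
      · rintro ⟨a, -⟩; exact a
    · exact ENNReal.ofReal_ne_top
  · refine Measurable.aemeasurable ?_
    have : Measurable (fun p : ℝ × ℝ => polarCoord.symm p) := by
      have : (fun p : ℝ × ℝ => polarCoord.symm p) = fun p => (p.1 * Real.cos p.2, p.1 * Real.sin p.2) := by
        funext p; rw [polarCoord_symm_apply]
      rw [this]; fun_prop
    simp only [smul_eq_mul]
    exact (measurable_fst.ennreal_ofReal).mul (hm.comp this)

lemma inv1 {lam : ℝ} (h : -(1/2 : ℝ) < lam) {g : ℝ → ℝ≥0∞} (hg : Measurable g) (s : ℝ) :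
    ∫⁻ x in Set.Ioi 0, ENNReal.ofReal (x ^ (2 * lam + 1)) * ∫⁻ φ, g (Real.sqrt (A2 x s φ)) ∂ρw lam
      = ENNReal.ofReal (kap lam) * ∫⁻ x in Set.Ioi 0, ENNReal.ofReal (x ^ (2 * lam + 1)) * g x := by
  rw [inv0 lam hg, ← inv0 lam hg 0, ← lintegral_const_mul' _ _ ENNReal.ofReal_ne_top]
  refine setLIntegral_congr_fun measurableSet_Ioi fun r hr => ?_
  have hr : 0 < r := hr
  have : ∀ φ, Real.sqrt (A2 r 0 φ) = r := by
    intro φ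
    rw [← Real.sqrt_sq hr.le]
    congr 1
    unfold A2; rw [Real.sqrt_sq hr.le]; ring
  simp only [this, lintegral_const, ρw_univ h]
  ring

lemma dens_meas (lam : ℝ) : Measurable fun x : ℝ => ENNReal.ofReal (blam lam / 2 * |x| ^ (2 * lam + 1)) := by
  fun_prop

lemma split_lint (F : ℝ → ℝ≥0∞) (hF : Measurable F) :
    ∫⁻ x, F x = (∫⁻ x in Set.Ioi 0, F x) + ∫⁻ x in Set.Ioi 0, F (-x) := by
  have e : ∫⁻ x in Set.Ioi (0:ℝ), F (-x) = ∫⁻ x in Set.Iio (0:ℝ), F x := by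
    have := (Measure.measurePreserving_neg (volume : Measure ℝ)).setLIntegral_comp_preimage
      (s := Set.Iio (0:ℝ)) measurableSet_Iio hF
    rw [← this]
    congr 2
    ext x; simp
  rw [e, ← setLIntegral_univ, ← lintegral_add_compl (μ := volume.restrict Set.univ) F (measurableSet_Ioi (a := (0:ℝ)))]
  simp only [Measure.restrict_univ, Set.compl_Ioi]
  congr 1
  exact setLIntegral_congr Iio_ae_eq_Iic.symm

lemma blam_pos {lam : ℝ} (h : -(1/2 : ℝ) < lam) : 0 < blam lam := by
  unfold blam
  have := Real.Gamma_pos_of_pos (by linarith : 0 < lam + 1)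
  positivity

lemma μw_lint {lam : ℝ} (F : ℝ → ℝ≥0∞) (hF : Measurable F) (h : -(1/2 : ℝ) < lam) :
    ∫⁻ x, F x ∂μw lam = ENNReal.ofReal (blam lam / 2) *
      ((∫⁻ x in Set.Ioi 0, ENNReal.ofReal (x ^ (2 * lam + 1)) * F x) +
        ∫⁻ x in Set.Ioi 0, ENNReal.ofReal (x ^ (2 * lam + 1)) * F (-x)) := by
  unfold μw
  have hb := blam_pos h
  rw [lintegral_withDensity_eq_lintegral_mul _ (dens_meas lam) hF, split_lint _ ((dens_meas lam).mul hF),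
    mul_add, ← lintegral_const_mul' _ _ ENNReal.ofReal_ne_top,
    ← lintegral_const_mul' _ _ ENNReal.ofReal_ne_top]
  congr 1
  · refine setLIntegral_congr_fun measurableSet_Ioi fun r hr => ?_
    have hr : 0 < r := hr
    simp only [Pi.mul_apply]
    rw [abs_of_pos hr, ENNReal.ofReal_mul (by positivity), mul_assoc]
  · refine setLIntegral_congr_fun measurableSet_Ioi fun r hr => ?_
    have hr : 0 < r := hr
    simp only [Pi.mul_apply]
    rw [abs_neg, abs_of_pos hr, ENNReal.ofReal_mul (by positivity), mul_assoc]

instance ρw_sfin (lam : ℝ) : SFinite (ρw lam) := by unfold ρw; infer_instance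

lemma Sg_meas {lam : ℝ} {g : ℝ → ℝ≥0∞} (hg : Measurable g) (s : ℝ) :
    Measurable (fun x => ∫⁻ φ, g (Real.sqrt (A2 x s φ)) ∂ρw lam) := by
  refine Measurable.lintegral_prod_right' (f := fun p : ℝ × ℝ => g (Real.sqrt (A2 p.1 s p.2))) ?_
  unfold A2
  fun_prop

lemma inv2 {lam : ℝ} (h : -(1/2 : ℝ) < lam) {g : ℝ → ℝ≥0∞} (hg : Measurable g)
    (he : ∀ x, g (-x) = g x) (s : ℝ) :
    ∫⁻ x, ∫⁻ φ, g (Real.sqrt (A2 x s φ)) ∂ρw lam ∂μw lam =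
      ENNReal.ofReal (kap lam) * ∫⁻ x, g x ∂μw lam := by
  rw [μw_lint _ (Sg_meas hg s) h, μw_lint _ hg h]
  have : ∀ x φ, A2 (-x) s φ = A2 x (-s) φ := by intro x φ; unfold A2; ring
  simp only [this, he, inv1 h hg]
  ring

lemma jensen {lam : ℝ} (h : -(1/2 : ℝ) < lam) {g : ℝ → ℝ≥0∞} (hg : Measurable g) {p : ℝ} (hp : 1 ≤ p) :
    (∫⁻ φ, g φ ∂ρw lam) ^ p ≤ ENNReal.ofReal (kap lam) ^ (p - 1) * ∫⁻ φ, g φ ^ p ∂ρw lam := by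
  have := eLpNorm'_le_eLpNorm'_mul_rpow_measure_univ (μ := ρw lam) (f := g) one_pos hp
    hg.aestronglyMeasurable
  have hp0 : 0 < p := by linarith
  rw [eLpNorm', eLpNorm', ρw_univ h] at this
  simp only [enorm_eq_self, ENNReal.rpow_one, div_one] at this
  have h2 := ENNReal.rpow_le_rpow this hp0.le
  refine h2.trans_eq ?_
  rw [ENNReal.mul_rpow_of_nonneg _ _ hp0.le, ← ENNReal.rpow_mul, ← ENNReal.rpow_mul,
    one_div_mul_cancel hp0.ne', ENNReal.rpow_one, mul_comm]
  congr 2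
  field_simp

/-- symmetrised modulus -/
def Gs (f : ℝ → ℂ) (r : ℝ) : ℝ≥0∞ := ‖f r‖ₑ + ‖f (-r)‖ₑ

lemma T_pt {lam : ℝ} (f : ℝ → ℂ) (s x : ℝ) :
    ‖T lam s f x‖ₑ ≤ ENNReal.ofReal |clam lam| * ∫⁻ φ, Gs f (Real.sqrt (A2 x s φ)) ∂ρw lam := by
  unfold T
  rw [enorm_mul]
  have h1 : ‖((clam lam / 2 : ℝ) : ℂ)‖ₑ = ENNReal.ofReal (|clam lam| / 2) := by
    rw [← ofReal_norm, Complex.norm_real, Real.norm_eq_abs, abs_div, abs_two]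
  have h2 : ENNReal.ofReal |clam lam| = ENNReal.ofReal (|clam lam| / 2) * 2 := by
    rw [show (2 : ℝ≥0∞) = ENNReal.ofReal 2 by simp, ← ENNReal.ofReal_mul (by positivity)]
    congr 1; ring
  rw [h1, h2, mul_assoc (ENNReal.ofReal _) 2]
  gcongr
  refine le_trans (enorm_integral_le_lintegral_enorm _) ?_
  rw [ρw_lint, ← lintegral_const_mul' _ _ (by simp)]
  refine setLIntegral_mono' measurableSet_Ioo fun φ hφ => ?_
  change ‖(f (Real.sqrt (A2 x s φ)) * (1 + (((x - s * Real.cos φ) / Real.sqrt (A2 x s φ) : ℝ) : ℂ)) +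
    f (-Real.sqrt (A2 x s φ)) * (1 - (((x - s * Real.cos φ) / Real.sqrt (A2 x s φ) : ℝ) : ℂ))) *
    ((ww lam φ : ℝ) : ℂ)‖ₑ ≤ _
  have hB := abs_le.1 (B_le x s φ)
  set B := (x - s * Real.cos φ) / Real.sqrt (A2 x s φ)
  have b1 : ‖(1 + (B : ℂ))‖ₑ ≤ 2 := by
    rw [← ofReal_norm, show (1 + (B:ℂ)) = ((1 + B : ℝ) : ℂ) by push_cast; rfl,
      Complex.norm_real, show (2 : ℝ≥0∞) = ENNReal.ofReal 2 by simp]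
    apply ENNReal.ofReal_le_ofReal
    rw [Real.norm_eq_abs, abs_le]; constructor <;> linarith
  have b2 : ‖(1 - (B : ℂ))‖ₑ ≤ 2 := by
    rw [← ofReal_norm, show (1 - (B:ℂ)) = ((1 - B : ℝ) : ℂ) by push_cast; rfl,
      Complex.norm_real, show (2 : ℝ≥0∞) = ENNReal.ofReal 2 by simp]
    apply ENNReal.ofReal_le_ofReal
    rw [Real.norm_eq_abs, abs_le]; constructor <;> linarith
  have b3 : ‖((ww lam φ : ℝ) : ℂ)‖ₑ = ENNReal.ofReal (ww lam φ) := by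
    rw [← ofReal_norm, Complex.norm_real, Real.norm_of_nonneg (ww_nonneg hφ)]
  rw [enorm_mul, b3]
  calc _ ≤ (‖f (Real.sqrt (A2 x s φ))‖ₑ * 2 + ‖f (-Real.sqrt (A2 x s φ))‖ₑ * 2) * ENNReal.ofReal (ww lam φ) := by
        gcongr
        refine (enorm_add_le _ _).trans ?_
        rw [enorm_mul, enorm_mul]
        gcongr
    _ = _ := by unfold Gs; ring

lemma vol_ac {lam : ℝ} (h : -(1/2 : ℝ) < lam) : (volume : Measure ℝ) ≪ μw lam := by
  unfold μw
  refine withDensity_absolutelyContinuous' (dens_meas lam).aemeasurable ?_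
  have : ∀ᵐ x : ℝ, x ≠ 0 := by simp [ae_iff]
  filter_upwards [this] with x hx
  have := blam_pos h
  have h3 : 0 < |x| := abs_pos.2 hx
  have : 0 < blam lam / 2 * |x| ^ (2 * lam + 1) := by positivity
  simp [this]

lemma sup_pt {lam : ℝ} (h : -(1/2 : ℝ) < lam) {f : ℝ → ℂ} (hf : Continuous f) (x : ℝ) :
    ‖f x‖ₑ ≤ eLpNorm f ⊤ (μw lam) := by
  have h1 : ∀ᵐ x ∂μw lam, ‖f x‖ₑ ≤ eLpNorm f ⊤ (μw lam) := by
    simp only [eLpNorm_exponent_top]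
    exact ae_le_eLpNormEssSup
  have h2 := (vol_ac h).ae_le h1
  have ho : IsOpen {x | ¬ ‖f x‖ₑ ≤ eLpNorm f ⊤ (μw lam)} := by
    simp only [not_le]
    exact isOpen_lt continuous_const hf.enorm
  by_contra hx
  have := (ho.measure_eq_zero_iff volume).1 h2
  have : x ∈ (∅ : Set ℝ) := this ▸ hx
  exact this

lemma neg_norm {lam : ℝ} (h : -(1/2 : ℝ) < lam) {f : ℝ → ℂ} (hf : Continuous f) (p : ℝ) :
    ∫⁻ x, ‖f (-x)‖ₑ ^ p ∂μw lam = ∫⁻ x, ‖f x‖ₑ ^ p ∂μw lam := by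
  have m1 : Measurable fun x => ‖f x‖ₑ ^ p := hf.enorm.measurable.pow_const p
  have m2 : Measurable fun x => ‖f (-x)‖ₑ ^ p := m1.comp measurable_neg
  rw [μw_lint _ m1 h, μw_lint _ m2 h]
  simp only [neg_neg]
  rw [add_comm]

theorem T_norm {lam : ℝ} (h : -(1/2 : ℝ) < lam) {f : ℝ → ℂ} (hf : Continuous f) (s : ℝ)
    {p : ℝ≥0∞} (hp : 1 ≤ p) :
    eLpNorm (T lam s f) p (μw lam) ≤
      ENNReal.ofReal (2 * |clam lam * kap lam|) * eLpNorm f p (μw lam) := by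
  have hk := kap_pos h
  have hGc : Continuous (Gs f) := hf.enorm.add (hf.comp continuous_neg).enorm
  have hGe : ∀ x, Gs f (-x) = Gs f x := by intro x; unfold Gs; rw [neg_neg, add_comm]
  have hconst : ENNReal.ofReal (2 * |clam lam * kap lam|) =
      ENNReal.ofReal |clam lam| * (2 * ENNReal.ofReal (kap lam)) := by
    rw [show (2 : ℝ≥0∞) = ENNReal.ofReal 2 by simp, ← ENNReal.ofReal_mul (by positivity),
      ← ENNReal.ofReal_mul (by positivity), abs_mul, abs_of_pos hk]
    congr 1; ring
  rw [hconst]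
  by_cases hpt : p = ⊤
  · subst hpt
    rw [eLpNorm_exponent_top]
    refine eLpNormEssSup_le_of_ae_enorm_bound (Filter.Eventually.of_forall fun x => ?_)
    refine (T_pt f s x).trans ?_
    rw [mul_assoc]
    gcongr
    calc _ ≤ ∫⁻ φ, 2 * eLpNorm f ⊤ (μw lam) ∂ρw lam := by
          refine lintegral_mono fun φ => ?_
          unfold Gs
          rw [two_mul]
          exact add_le_add (sup_pt h hf _) (sup_pt h hf _)
      _ = _ := by rw [lintegral_const, ρw_univ h]; ring
  · have hp0 : p ≠ 0 := by rintro rfl; simp at hp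
    have hr : 1 ≤ p.toReal := by
      rw [← ENNReal.toReal_one]; exact ENNReal.toReal_mono hpt hp
    have hr0 : 0 < p.toReal := by linarith
    have hP : eLpNorm (Gs f) p (μw lam) ≤ 2 * eLpNorm f p (μw lam) := by
      have e1 : Gs f = (fun x => ‖f x‖ₑ) + (fun x => ‖f (-x)‖ₑ) := rfl
      rw [e1]
      refine (eLpNorm_add_le hf.enorm.aestronglyMeasurable
        (hf.comp continuous_neg).enorm.aestronglyMeasurable hp).trans ?_
      rw [two_mul]
      refine add_le_add (le_of_eq ?_) (le_of_eq ?_)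
      · rw [eLpNorm_eq_lintegral_rpow_enorm_toReal hp0 hpt, eLpNorm_eq_lintegral_rpow_enorm_toReal hp0 hpt]
        simp only [enorm_eq_self]
      · rw [eLpNorm_eq_lintegral_rpow_enorm_toReal hp0 hpt, eLpNorm_eq_lintegral_rpow_enorm_toReal hp0 hpt]
        simp only [enorm_eq_self]
        simp only [Function.comp_apply]
        rw [neg_norm h hf]
    have hmain : eLpNorm (fun x => ∫⁻ φ, Gs f (Real.sqrt (A2 x s φ)) ∂ρw lam) p (μw lam) ≤
        ENNReal.ofReal (kap lam) * eLpNorm (Gs f) p (μw lam) := by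
      rw [eLpNorm_eq_lintegral_rpow_enorm_toReal hp0 hpt, eLpNorm_eq_lintegral_rpow_enorm_toReal hp0 hpt]
      simp only [enorm_eq_self]
      calc _ ≤ (∫⁻ x, ENNReal.ofReal (kap lam) ^ (p.toReal - 1) *
              ∫⁻ φ, Gs f (Real.sqrt (A2 x s φ)) ^ p.toReal ∂ρw lam ∂μw lam) ^ (1 / p.toReal) := by
            gcongr with x
            refine jensen h ?_ hr
            refine (hGc.comp ?_).measurable
            unfold A2; fun_prop
        _ = (ENNReal.ofReal (kap lam) ^ p.toReal * ∫⁻ x, Gs f x ^ p.toReal ∂μw lam) ^ (1 / p.toReal) := by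
            rw [lintegral_const_mul' _ _ (ENNReal.rpow_ne_top_of_nonneg (by linarith) ENNReal.ofReal_ne_top),
              inv2 (g := fun r => Gs f r ^ p.toReal) h (hGc.measurable.pow_const _) (fun x => by rw [hGe]),
              ← mul_assoc]
            congr 2
            have k0 : ENNReal.ofReal (kap lam) ≠ 0 := by simpa using hk
            conv_rhs => rw [show p.toReal = (p.toReal - 1) + 1 by ring,
              ENNReal.rpow_add _ _ k0 ENNReal.ofReal_ne_top, ENNReal.rpow_one]
        _ = _ := by
            rw [ENNReal.mul_rpow_of_nonneg _ _ (by positivity), ← ENNReal.rpow_mul,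
              mul_one_div_cancel hr0.ne', ENNReal.rpow_one]
    calc _ ≤ ENNReal.ofReal |clam lam| * eLpNorm (fun x => ∫⁻ φ, Gs f (Real.sqrt (A2 x s φ)) ∂ρw lam) p (μw lam) := by
          rw [eLpNorm_eq_lintegral_rpow_enorm_toReal hp0 hpt, eLpNorm_eq_lintegral_rpow_enorm_toReal hp0 hpt]
          simp only [enorm_eq_self]
          have e2 : ENNReal.ofReal |clam lam| = (ENNReal.ofReal |clam lam| ^ p.toReal) ^ (1 / p.toReal) := by
            rw [← ENNReal.rpow_mul, mul_one_div_cancel hr0.ne', ENNReal.rpow_one]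
          rw [e2, ← ENNReal.mul_rpow_of_nonneg _ _ (by positivity),
            ← lintegral_const_mul' _ _ (ENNReal.rpow_ne_top_of_nonneg hr0.le ENNReal.ofReal_ne_top)]
          gcongr with x
          rw [← ENNReal.mul_rpow_of_nonneg _ _ hr0.le]
          gcongr
          exact T_pt f s x
      _ ≤ ENNReal.ofReal |clam lam| * (ENNReal.ofReal (kap lam) * (2 * eLpNorm f p (μw lam))) := by
          gcongr
          exact hmain.trans (by gcongr)
      _ = _ := by ring

section vec
variable {E : Type*} [NormedAddCommGroup E] [NormedSpace ℂ E] [CompleteSpace E]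

lemma cosh_le_exp' {x : ℝ} (hx : 0 ≤ x) : Real.cosh x ≤ Real.exp x := by
  rw [Real.cosh_eq]
  have : Real.exp (-x) ≤ Real.exp x := Real.exp_le_exp.2 (by linarith)
  linarith

lemma vterm {v : ℕ → E} {C τ : ℝ} (hτ : 0 ≤ τ)
    (hv : ∀ k, ‖v k‖ ≤ C * (τ ^ (2 * k) / (2 * k).factorial)) {w : ℂ} {r : ℝ} (hr : 0 ≤ r)
    (hw : ‖w‖ ≤ r ^ 2) (k : ℕ) :
    ‖w ^ k • v k‖ ≤ C * ((τ * r) ^ (2 * k) / (2 * k).factorial) := by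
  rw [norm_smul, norm_pow]
  calc _ ≤ (r ^ 2) ^ k * (C * (τ ^ (2 * k) / (2 * k).factorial)) := by
        gcongr; exact hv k
    _ = _ := by rw [mul_pow, ← pow_mul]; ring

def ks (v : ℕ → E) (w : ℂ) : E := ∑' k, w ^ k • v k

lemma ks_summable {v : ℕ → E} {C τ : ℝ} (hτ : 0 ≤ τ)
    (hv : ∀ k, ‖v k‖ ≤ C * (τ ^ (2 * k) / (2 * k).factorial)) (w : ℂ) :
    Summable fun k => w ^ k • v k := by
  refine Summable.of_norm_bounded ((Real.hasSum_cosh (τ * Real.sqrt ‖w‖)).summable.mul_left C) ?_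
  exact vterm hτ hv (Real.sqrt_nonneg _) (Real.sq_sqrt (norm_nonneg _)).ge

lemma ks_bound {v : ℕ → E} {C τ : ℝ} (hτ : 0 ≤ τ)
    (hv : ∀ k, ‖v k‖ ≤ C * (τ ^ (2 * k) / (2 * k).factorial)) {w : ℂ} {r : ℝ} (hr : 0 ≤ r)
    (hw : ‖w‖ ≤ r ^ 2) : ‖ks v w‖ ≤ C * Real.exp (τ * r) := by
  have hC : 0 ≤ C := by have := (norm_nonneg _).trans (hv 0); simpa using this
  refine (tsum_of_norm_bounded ((Real.hasSum_cosh (τ * r)).mul_left C) (vterm hτ hv hr hw)).trans ?_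
  gcongr
  exact cosh_le_exp' (by positivity)

lemma ks_diff {v : ℕ → E} {C τ : ℝ} (hτ : 0 ≤ τ)
    (hv : ∀ k, ‖v k‖ ≤ C * (τ ^ (2 * k) / (2 * k).factorial)) : Differentiable ℂ (ks v) := by
  intro w
  set r : ℝ := ‖w‖ + 1 with hr
  have hr1 : 1 ≤ r := by rw [hr]; linarith [norm_nonneg w]
  have key := Complex.differentiableOn_tsum_of_summable_norm (U := Metric.ball 0 r)
    (F := fun k (w : ℂ) => w ^ k • v k)
    ((Real.hasSum_cosh (τ * r)).summable.mul_left C)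
    (fun k => ((differentiable_id.pow k).smul_const (v k)).differentiableOn) Metric.isOpen_ball
    (fun k y hy => vterm hτ hv (by linarith) (by
      have : ‖y‖ < r := by simpa using hy
      nlinarith) k)
  exact (key.differentiableAt (Metric.isOpen_ball.mem_nhds (by simp [hr])))

lemma vshift {v : ℕ → E} {C τ : ℝ} (hτ : 0 ≤ τ)
    (hv : ∀ k, ‖v k‖ ≤ C * (τ ^ (2 * k) / (2 * k).factorial)) (k : ℕ) :
    ‖v (k + 1)‖ ≤ (C * τ ^ 2) * (τ ^ (2 * k) / (2 * k).factorial) := by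
  have hC : 0 ≤ C := by have := (norm_nonneg _).trans (hv 0); simpa using this
  refine (hv (k + 1)).trans ?_
  rw [mul_assoc, ← mul_div_assoc (τ ^ 2), ← pow_add, show 2 + 2 * k = 2 * (k + 1) by ring]
  gcongr
  omega

lemma ks_deriv {v : ℕ → E} {C τ : ℝ} (hτ : 0 ≤ τ)
    (hv : ∀ k, ‖v k‖ ≤ C * (τ ^ (2 * k) / (2 * k).factorial)) : deriv (ks v) 0 = v 1 := by
  have e : ks v = fun w => v 0 + w • ks (fun k => v (k + 1)) w := by
    funext w
    unfold ks
    rw [(ks_summable hτ hv w).tsum_eq_zero_add, ← tsum_const_smul'' w]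
    simp [pow_succ', mul_smul]
  have hd := (ks_diff hτ (vshift hτ hv) 0).hasDerivAt
  have := ((hasDerivAt_id (0:ℂ)).smul hd).const_add (v 0)
  rw [e]
  refine this.deriv.trans ?_
  simp only [id_eq, zero_smul, one_smul, zero_add]
  unfold ks
  rw [tsum_eq_single 0]
  · simp
  · intro n hn; simp [hn]

theorem bern_vec {v : ℕ → E} {C τ D : ℝ} (hτ : 0 < τ)
    (hv : ∀ k, ‖v k‖ ≤ C * (τ ^ (2 * k) / (2 * k).factorial))
    (hD : ∀ s : ℝ, ‖∑' k, ((s ^ (2 * k) : ℝ) : ℂ) • v k‖ ≤ D) :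
    ‖v 1‖ ≤ Real.exp 1 * τ ^ 2 * D := by
  have hC : 0 ≤ C := by have := (norm_nonneg _).trans (hv 0); simpa using this
  have hs : ∀ z : ℂ, ‖-z ^ 2‖ ≤ ‖z‖ ^ 2 := fun z => by rw [norm_neg, norm_pow]
  set H : ℂ → E := fun z => Complex.exp (-(τ * z)) • ks v (-z ^ 2) with hH
  have hHd : Differentiable ℂ H := by
    have h1 : Differentiable ℂ (fun z : ℂ => ks v (-z ^ 2)) :=
      (ks_diff hτ.le hv).comp (by fun_prop)
    have h2 : Differentiable ℂ (fun z : ℂ => Complex.exp (-(τ * z))) := by fun_prop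
    exact h2.smul h1
  have hexpn : ∀ z : ℂ, ‖Complex.exp (-(τ * z))‖ = Real.exp (-(τ * z.re)) := by
    intro z; rw [Complex.norm_exp]; simp
  have hHle : ∀ z : ℂ, ‖H z‖ ≤ Real.exp (-(τ * z.re)) * (C * Real.exp (τ * ‖z‖)) := by
    intro z
    rw [hH]; simp only
    rw [norm_smul, hexpn]
    gcongr
    exact ks_bound hτ.le hv (norm_nonneg _) (hs z)
  have hPL : ∀ z : ℂ, 0 ≤ z.re → ‖H z‖ ≤ D := by
    intro z hz
    refine PhragmenLindelof.right_half_plane_of_bounded_on_real hHd.diffContOnCl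
      ⟨1, by norm_num, τ, ?_⟩ ?_ ?_ hz
    · refine Asymptotics.IsBigO.of_bound C ?_
      rw [Filter.eventually_inf_principal]
      refine Filter.Eventually.of_forall fun z hz => ?_
      have hz : 0 < z.re := hz
      refine (hHle z).trans ?_
      rw [Real.rpow_one, Real.norm_of_nonneg (Real.exp_pos _).le]
      have : Real.exp (-(τ * z.re)) ≤ 1 := Real.exp_le_one_iff.2 (by nlinarith)
      exact mul_le_of_le_one_left (by positivity) this
    · refine Filter.isBoundedUnder_of_eventually_le (a := C) ?_
      filter_upwards [Filter.eventually_ge_atTop 0] with x hx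
      refine (hHle x).trans_eq ?_
      rw [Complex.norm_real, Real.norm_of_nonneg hx, Complex.ofReal_re, mul_left_comm, ← Real.exp_add]
      simp
    · intro y
      rw [hH]; simp only
      rw [norm_smul, hexpn]
      have := hD y
      have e : (-((y:ℂ) * Complex.I) ^ 2) = (y:ℂ) ^ 2 := by
        rw [mul_pow, Complex.I_sq]; ring
      rw [e]
      simp only [Complex.mul_re, Complex.ofReal_re, Complex.I_re, mul_zero, Complex.ofReal_im,
        Complex.I_im, mul_one, sub_self, neg_zero, Real.exp_zero, one_mul]
      unfold ks
      simp_rw [← pow_mul]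
      simpa using this
  have hk : ∀ w ∈ Metric.sphere (0:ℂ) ((1 / τ) ^ 2), ‖ks v w‖ ≤ D * Real.exp 1 := by
    intro w hw
    have hw : ‖w‖ = (1 / τ) ^ 2 := by simpa using hw
    obtain ⟨z0, hz0⟩ := IsAlgClosed.exists_pow_nat_eq (-w) (n := 2) two_pos
    have hz0 := hz0.symm
    obtain ⟨z, hz, hre⟩ : ∃ z : ℂ, -w = z ^ 2 ∧ 0 ≤ z.re := by
      rcases le_total 0 z0.re with h | h
      · exact ⟨z0, hz0, h⟩
      · exact ⟨-z0, by rw [hz0, neg_sq], by simpa using h⟩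
    have hnz : ‖z‖ = 1 / τ := by
      have : ‖z‖ ^ 2 = (1 / τ) ^ 2 := by rw [← hw, ← norm_pow, ← hz, norm_neg]
      exact (pow_left_inj₀ (norm_nonneg _) (by positivity) two_ne_zero).1 this
    have h1 := hPL z hre
    rw [hH] at h1; simp only at h1
    rw [norm_smul, hexpn, ← hz, neg_neg, Real.exp_neg] at h1
    have h2 : ‖ks v w‖ ≤ D * Real.exp (τ * z.re) := by
      rwa [inv_mul_le_iff₀ (Real.exp_pos _), mul_comm] at h1
    refine h2.trans ?_
    have hD0 : 0 ≤ D := (norm_nonneg _).trans (hD 0)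
    gcongr
    have := (Complex.re_le_norm z).trans_eq hnz
    calc τ * z.re ≤ τ * (1 / τ) := by gcongr
      _ = 1 := by field_simp
  have := Complex.norm_deriv_le_of_forall_mem_sphere_norm_le (by positivity : 0 < (1 / τ) ^ 2)
    (ks_diff hτ.le hv).diffContOnCl hk
  rw [ks_deriv hτ.le hv] at this
  refine this.trans_eq ?_
  field_simp

end vec

lemma clam_pos {lam : ℝ} (h : -(1/2 : ℝ) < lam) : 0 < clam lam := by
  unfold clam
  have h1 := Real.Gamma_pos_of_pos (by linarith : 0 < lam + 1)
  have h2 := Real.Gamma_pos_of_pos (by linarith : 0 < lam + 1/2)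
  have := Real.sqrt_pos.2 pi_pos
  positivity

/-- the term of the translation series -/
def tt (lam s : ℝ) (b : ℕ → ℂ) (k : ℕ) (x : ℝ) : ℂ :=
  ((s ^ (2 * k) / dd lam (2 * k) : ℝ) : ℂ) * Fb lam (sh k b) x

lemma Ts_norm {lam : ℝ} (h : -(1/2 : ℝ) < lam) {c τ : ℝ} (hτ : 0 ≤ τ) {b : ℕ → ℂ}
    (hb : Bd c τ b) (s : ℝ) {p : ℝ≥0∞} (hp : 1 ≤ p) :
    eLpNorm (fun x => ∑' k, tt lam s b k x) p (μw lam) ≤ 2 * eLpNorm (Fb lam b) p (μw lam) := by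
  have hκ : 0 < clam lam * kap lam := mul_pos (clam_pos h) (kap_pos h)
  have h1 := T_norm h (Fb_continuous h hτ hb) s hp
  have e : T lam s (Fb lam b) = ((clam lam * kap lam : ℝ) : ℂ) • (fun x => ∑' k, tt lam s b k x) := by
    funext x
    exact (T_sum h hτ hb s x).2
  have e2 : ‖((clam lam * kap lam : ℝ) : ℂ)‖ₑ = ENNReal.ofReal (clam lam * kap lam) := by
    rw [← ofReal_norm, Complex.norm_real, Real.norm_of_nonneg hκ.le]
  rw [e, eLpNorm_const_smul, e2, abs_of_pos hκ, mul_comm 2, ENNReal.ofReal_mul hκ.le, mul_assoc] at h1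
  have k0 : ENNReal.ofReal (clam lam * kap lam) ≠ 0 := by simpa using hκ
  have := (ENNReal.mul_le_mul_iff_right k0 ENNReal.ofReal_ne_top).1 h1
  simpa using this

lemma tsum_norm {μ : Measure ℝ} {p : ℝ≥0∞} (hp : 1 ≤ p) {g : ℕ → ℝ → ℂ}
    (hg : ∀ k, Continuous (g k)) (hs : ∀ᵐ x ∂μ, Summable fun k => g k x) {u : ℕ → ℝ}
    (hu0 : ∀ k, 0 ≤ u k) (hu : Summable u) (hgu : ∀ k, eLpNorm (g k) p μ ≤ ENNReal.ofReal (u k)) :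
    eLpNorm (fun x => ∑' k, g k x) p μ ≤ ENNReal.ofReal (∑' k, u k) := by
  refine Lp.eLpNorm_le_of_ae_tendsto (u := Filter.atTop)
    (f := fun N : ℕ => ∑ k ∈ Finset.range N, g k) ?_ ?_ ?_
  · refine Filter.Eventually.of_forall fun N => ?_
    refine (eLpNorm_sum_le (fun k _ => (hg k).aestronglyMeasurable) hp).trans ?_
    calc _ ≤ ∑ k ∈ Finset.range N, ENNReal.ofReal (u k) := Finset.sum_le_sum fun k _ => hgu k
      _ = ENNReal.ofReal (∑ k ∈ Finset.range N, u k) := (ENNReal.ofReal_sum_of_nonneg fun k _ => hu0 k).symm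
      _ ≤ _ := ENNReal.ofReal_le_ofReal (hu.sum_le_tsum _ fun k _ => hu0 k)
  · intro N
    exact Finset.aestronglyMeasurable_sum _ fun k _ => (hg k).aestronglyMeasurable
  · filter_upwards [hs] with x hx
    simp only [Finset.sum_apply]
    exact hx.hasSum.tendsto_sum_nat

lemma meas_tsum {g : ℕ → ℝ → ℂ} (hg : ∀ k, Continuous (g k)) (hs : ∀ x, Summable fun k => g k x) :
    Measurable (fun x => ∑' k, g k x) := by
  refine measurable_of_tendsto_metrizable (f := fun N x => ∑ k ∈ Finset.range N, g k x)
    (fun N => Finset.measurable_sum _ fun k _ => (hg k).measurable) ?_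
  rw [tendsto_pi_nhds]
  intro x
  exact (hs x).hasSum.tendsto_sum_nat

lemma Fb_cont_sh {lam : ℝ} (h : -(1/2 : ℝ) < lam) {c τ : ℝ} (hτ : 0 ≤ τ) {b : ℕ → ℂ}
    (hb : Bd c τ b) (k : ℕ) : Continuous (Fb lam (sh k b)) := Fb_continuous h hτ (hb.sh k)

instance μw_lf {lam : ℝ} (R : ℝ) [hlam : Fact (-(1/2 : ℝ) < lam)] :
    IsFiniteMeasure ((μw lam).restrict (Set.Icc (-R) R)) := by
  have h := hlam.out
  refine ⟨?_⟩
  rw [Measure.restrict_apply_univ, μw, withDensity_apply _ measurableSet_Icc]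
  refine (setLIntegral_mono' (g := fun _ => ENNReal.ofReal (blam lam / 2 * R ^ (2 * lam + 1))) measurableSet_Icc fun x hx => ?_).trans_lt ?_
  · have := blam_pos h
    have hx : |x| ≤ R := abs_le.2 hx
    apply ENNReal.ofReal_le_ofReal
    gcongr
    linarith
  · rw [setLIntegral_const]
    exact ENNReal.mul_lt_top ENNReal.ofReal_lt_top (by simp)

set_option maxHeartbeats 1000000 in
theorem bern {lam : ℝ} (h : -(1/2 : ℝ) < lam) {c τ : ℝ} (hτ : 0 < τ) {b : ℕ → ℂ}
    (hb : Bd c τ b) {p : ℝ≥0∞} (hp : 1 ≤ p) (hfin : eLpNorm (Fb lam b) p (μw lam) ≠ ⊤) :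
    eLpNorm (Fb lam (sh 1 b)) p (μw lam) ≤
      ENNReal.ofReal (2 * Real.exp 1 * dd lam 2 * τ ^ 2) * eLpNorm (Fb lam b) p (μw lam) := by
  haveI : Fact (1 ≤ p) := ⟨hp⟩
  haveI : Fact (-(1/2 : ℝ) < lam) := ⟨h⟩
  -- restricted estimate
  have hR : ∀ n : ℕ, eLpNorm (Fb lam (sh 1 b)) p ((μw lam).restrict (Set.Icc (-(n:ℝ)) n)) ≤
      ENNReal.ofReal (2 * Real.exp 1 * dd lam 2 * τ ^ 2) * eLpNorm (Fb lam b) p (μw lam) := by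
    intro n
    set ν := (μw lam).restrict (Set.Icc (-(n:ℝ)) n) with hν
    have hνle : ν ≤ μw lam := Measure.restrict_le_self
    have hbd : ∀ k, ∀ᵐ x ∂ν, ‖Fb lam (sh k b) x‖ ≤ c * τ ^ (2 * k) * Real.exp (τ * n) := by
      intro k
      filter_upwards [ae_restrict_mem measurableSet_Icc] with x hx
      refine (Fb_bound h hτ.le (hb.sh k) x).trans ?_
      have : |x| ≤ n := abs_le.2 hx
      have := (hb.sh k).c_nonneg
      gcongr
    have hM : ∀ k, MemLp (Fb lam (sh k b)) p ν := fun k =>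
      MemLp.of_bound (Fb_cont_sh h hτ.le hb k).aestronglyMeasurable _ (hbd k)
    set V : ℝ := (ν Set.univ ^ p.toReal⁻¹).toReal with hV
    have hVt : ν Set.univ ^ p.toReal⁻¹ ≠ ⊤ :=
      ENNReal.rpow_ne_top_of_nonneg (by positivity) (measure_ne_top _ _)
    have hnk : ∀ k, (eLpNorm (Fb lam (sh k b)) p ν) ≤ ENNReal.ofReal (V * (c * τ ^ (2 * k) * Real.exp (τ * n))) := by
      intro k
      refine (eLpNorm_le_of_ae_bound (hbd k)).trans_eq ?_
      rw [ENNReal.ofReal_mul ENNReal.toReal_nonneg, ENNReal.ofReal_toReal hVt]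
    have hc := hb.c_nonneg
    have hV0 : 0 ≤ V := ENNReal.toReal_nonneg
    set v : ℕ → Lp ℂ p ν := fun k => (((1 / dd lam (2 * k) : ℝ) : ℂ)) • (hM k).toLp _ with hv
    have hvn : ∀ k, ‖v k‖ ≤ (V * c * Real.exp (τ * n)) * (τ ^ (2 * k) / (2 * k).factorial) := by
      intro k
      rw [hv]; simp only
      rw [norm_smul, Complex.norm_real, Real.norm_of_nonneg (by have := dd_pos h (2*k); positivity),
        Lp.norm_toLp]
      have h1 : (eLpNorm (Fb lam (sh k b)) p ν).toReal ≤ V * (c * τ ^ (2 * k) * Real.exp (τ * n)) :=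
        ENNReal.toReal_le_of_le_ofReal (by positivity) (hnk k)
      have h2 : 1 / dd lam (2 * k) ≤ 1 / (2 * k).factorial :=
        one_div_le_one_div_of_le (by positivity) (dd_ge h _)
      refine (mul_le_mul h2 h1 ENNReal.toReal_nonneg (by positivity)).trans_eq (by ring)
    set D : ℝ := (2 * eLpNorm (Fb lam b) p (μw lam)).toReal with hD
    have h2t : 2 * eLpNorm (Fb lam b) p (μw lam) ≠ ⊤ := ENNReal.mul_ne_top (by simp) hfin
    have key := bern_vec (D := D) hτ hvn ?_
    · have e1 : ‖v 1‖ = 1 / dd lam 2 * (eLpNorm (Fb lam (sh 1 b)) p ν).toReal := by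
        rw [hv]; simp only
        rw [norm_smul, Complex.norm_real, Real.norm_of_nonneg (by have := dd_pos h (2*1); positivity),
          Lp.norm_toLp]
      rw [e1, one_div, inv_mul_le_iff₀ (dd_pos h 2)] at key
      rw [← ENNReal.ofReal_toReal (hM 1).2.ne]
      refine (ENNReal.ofReal_le_ofReal key).trans_eq ?_
      rw [hD, ENNReal.toReal_mul, ← mul_assoc, ← mul_assoc,
        ENNReal.ofReal_mul (by have := dd_pos h 2; positivity), ENNReal.ofReal_toReal hfin]
      congr 2
      simp only [ENNReal.toReal_ofNat]
      ring
    · intro s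
      have hsum : Summable fun k => ((s ^ (2 * k) : ℝ) : ℂ) • v k := by
        have := ks_summable hτ.le hvn ((s:ℂ) ^ 2)
        simp_rw [← pow_mul] at this
        simpa using this
      have htm : ∀ k, MemLp (tt lam s b k) p ν := fun k => (hM k).const_mul _
      have hterm : ∀ k, ((s ^ (2 * k) : ℝ) : ℂ) • v k = (htm k).toLp _ := by
        intro k
        rw [hv]; simp only
        rw [smul_smul, ← MemLp.toLp_const_smul]
        apply (MemLp.toLp_eq_toLp_iff _ _).2
        refine Filter.Eventually.of_forall fun x => ?_
        simp only [Pi.smul_apply, smul_eq_mul, tt]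
        push_cast; ring
      set u : ℕ → ℝ := fun k => V * c * Real.exp (τ * n) * ((τ * |s|) ^ (2 * k) / (2 * k).factorial) with hu
      have hus : Summable u := (Real.hasSum_cosh (τ * |s|)).summable.mul_left _
      have hu0 : ∀ k, 0 ≤ u k := fun k => by rw [hu]; positivity
      have hut : ∀ k, eLpNorm (tt lam s b k) p ν ≤ ENNReal.ofReal (u k) := by
        intro k
        have : tt lam s b k = ((s ^ (2 * k) / dd lam (2 * k) : ℝ) : ℂ) • Fb lam (sh k b) := rfl
        rw [this, eLpNorm_const_smul, ← ofReal_norm]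
        refine (mul_le_mul' (ENNReal.ofReal_le_ofReal (xd_le h s (2 * k))) (hnk k)).trans_eq ?_
        rw [← ENNReal.ofReal_mul (by positivity), hu]
        congr 1
        simp only [mul_pow]; ring
      have hbound : ∀ N : ℕ, ‖∑ k ∈ Finset.range N, ((s ^ (2 * k) : ℝ) : ℂ) • v k‖ ≤
          D + ∑' k, u (k + N) := by
        intro N
        have e1 : ∑ k ∈ Finset.range N, ((s ^ (2 * k) : ℝ) : ℂ) • v k =
            (memLp_finset_sum' (Finset.range N) (fun k _ => htm k)).toLp _ := by
          rw [Finset.sum_congr rfl fun k _ => hterm k]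
          induction N with
          | zero => simp
          | succ N ih =>
            rw [Finset.sum_range_succ, ih, ← MemLp.toLp_add]
            apply (MemLp.toLp_eq_toLp_iff _ _).2
            rw [Finset.sum_range_succ]
        rw [e1, Lp.norm_toLp]
        have e2 : (∑ k ∈ Finset.range N, tt lam s b k) =
            (fun x => ∑' k, tt lam s b k x) - (fun x => ∑' k, tt lam s b (k + N) x) := by
          funext x
          have hS : Summable fun k => tt lam s b k x := (T_sum h hτ.le hb s x).1
          rw [Finset.sum_apply, Pi.sub_apply, ← hS.sum_add_tsum_nat_add N]
          ring
        have hcont : ∀ k, Continuous (tt lam s b k) := fun k =>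
          continuous_const.mul (Fb_cont_sh h hτ.le hb k)
        have m1 : Measurable (fun x => ∑' k, tt lam s b k x) :=
          meas_tsum hcont fun x => (T_sum h hτ.le hb s x).1
        have m2 : Measurable (fun x => ∑' k, tt lam s b (k + N) x) :=
          meas_tsum (fun k => hcont (k + N)) fun x => (summable_nat_add_iff N).2 (T_sum h hτ.le hb s x).1
        have b1 : eLpNorm (fun x => ∑' k, tt lam s b k x) p ν ≤ 2 * eLpNorm (Fb lam b) p (μw lam) :=
          le_trans (eLpNorm_mono_measure _ hνle) (Ts_norm h hτ.le hb s hp)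
        have b2 : eLpNorm (fun x => ∑' k, tt lam s b (k + N) x) p ν ≤ ENNReal.ofReal (∑' k, u (k + N)) :=
          tsum_norm hp (fun k => hcont _)
            (Filter.Eventually.of_forall fun x => (summable_nat_add_iff N).2 (T_sum h hτ.le hb s x).1)
            (fun k => hu0 _) ((summable_nat_add_iff N).2 hus) (fun k => hut _)
        refine ENNReal.toReal_le_of_le_ofReal (add_nonneg ENNReal.toReal_nonneg (tsum_nonneg fun k => hu0 _)) ?_
        rw [e2, ENNReal.ofReal_add ENNReal.toReal_nonneg (tsum_nonneg fun k => hu0 _),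
          ENNReal.ofReal_toReal h2t]
        exact (eLpNorm_sub_le m1.aestronglyMeasurable m2.aestronglyMeasurable hp).trans (add_le_add b1 b2)
      have l1 := hsum.hasSum.tendsto_sum_nat.norm
      have l2 : Filter.Tendsto (fun N => D + ∑' k, u (k + N)) Filter.atTop (nhds (D + 0)) :=
        (tendsto_sum_nat_add u).const_add D
      rw [add_zero] at l2
      exact le_of_tendsto_of_tendsto' l1 l2 hbound
  refine Lp.eLpNorm_le_of_ae_tendsto (u := Filter.atTop)
    (f := fun n : ℕ => (Set.Icc (-(n:ℝ)) n).indicator (Fb lam (sh 1 b))) ?_ ?_ ?_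
  · refine Filter.Eventually.of_forall fun n => ?_
    rw [eLpNorm_indicator_eq_eLpNorm_restrict measurableSet_Icc]
    exact hR n
  · intro n
    exact (Fb_cont_sh h hτ.le hb 1).aestronglyMeasurable.indicator measurableSet_Icc
  · refine Filter.Eventually.of_forall fun x => ?_
    refine tendsto_const_nhds.congr' ?_
    obtain ⟨n0, hn0⟩ := exists_nat_ge |x|
    filter_upwards [Filter.eventually_ge_atTop n0] with n hn
    rw [Set.indicator_of_mem]
    have : |x| ≤ n := hn0.trans (by exact_mod_cast hn)
    exact abs_le.1 this

lemma dd_gamma {lam : ℝ} (h : -(1/2 : ℝ) < lam) (k : ℕ) :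
    dd lam (2 * k) * Real.Gamma (lam + 1) = 4 ^ k * k.factorial * Real.Gamma (k + lam + 1) := by
  induction k with
  | zero => simp [dd]
  | succ k ih =>
    have h1 : Real.Gamma (((k + 1 : ℕ) : ℝ) + lam + 1) = (k + lam + 1) * Real.Gamma (k + lam + 1) := by
      rw [← Real.Gamma_add_one]
      · congr 1; push_cast; ring
      · have : (0:ℝ) ≤ k := k.cast_nonneg
        linarith
    rw [h1, dd_even, dd_odd, Nat.factorial_succ, pow_succ]
    push_cast
    linear_combination (2 * k + 2 * lam + 2) * (2 * (k:ℝ) + 2) * ih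

lemma lap_int {lam : ℝ} (h : -(1/2 : ℝ) < lam) {x : ℝ} (hx : 0 < x) (k : ℕ) :
    IntegrableOn (fun r : ℝ => r ^ (k + lam) * Real.exp (-(x * r))) (Set.Ioi 0) := by
  have hk : (0:ℝ) ≤ k := k.cast_nonneg
  have := integrableOn_rpow_mul_exp_neg_mul_rpow (p := 1) (s := k + lam) (b := x) (by linarith) one_pos hx
  simpa using this


/-- terms of the Laplace transform -/
lemma lap_term {lam : ℝ} (h : -(1/2 : ℝ) < lam) {z : ℂ} (hz : 0 < z.re) (k : ℕ) :
    ∫ r in Set.Ioi (0:ℝ), ((r ^ (k + lam) : ℝ) : ℂ) * Complex.exp (-(z * r)) =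
      (1 / z) ^ ((k + lam + 1 : ℝ) : ℂ) * (Real.Gamma (k + lam + 1) : ℂ) := by
  have hk : (0:ℝ) ≤ k := k.cast_nonneg
  set U : Set ℂ := {w | 0 < w.re} with hU
  have hUo : IsOpen U := isOpen_lt continuous_const Complex.continuous_re
  have hUc : IsPreconnected U := (convex_halfSpace_re_gt 0).isPreconnected
  have hnorm : ∀ (w : ℂ) (r : ℝ), 0 < r → ‖((r ^ (k + lam) : ℝ) : ℂ) * Complex.exp (-(w * r))‖ =
      r ^ (k + lam) * Real.exp (-(w.re * r)) := by
    intro w r hr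
    rw [norm_mul, Complex.norm_real, Real.norm_of_nonneg (by positivity), Complex.norm_exp]
    simp
  have hmeas : ∀ w : ℂ, AEStronglyMeasurable (fun r : ℝ => ((r ^ (k + lam) : ℝ) : ℂ) * Complex.exp (-(w * r)))
      (volume.restrict (Set.Ioi 0)) := fun w => Measurable.aestronglyMeasurable (by fun_prop)
  have h1 : AnalyticOnNhd ℂ (fun w : ℂ => ∫ r in Set.Ioi (0:ℝ), ((r ^ (k + lam) : ℝ) : ℂ) * Complex.exp (-(w * r))) U := by
    refine DifferentiableOn.analyticOnNhd (fun w hw => ?_) hUo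
    have hw : 0 < w.re := hw
    refine DifferentiableAt.differentiableWithinAt ?_
    refine (hasDerivAt_integral_of_dominated_loc_of_deriv_le (s := Metric.ball w (w.re / 2))
      (F' := fun v r => ((r ^ (k + lam) : ℝ) : ℂ) * (Complex.exp (-(v * r)) * (-r)))
      (bound := fun r => r ^ (((k + 1 : ℕ) : ℝ) + lam) * Real.exp (-((w.re / 2) * r)))
      (Metric.ball_mem_nhds _ (by positivity)) (Filter.Eventually.of_forall hmeas) ?_ ?_ ?_ ?_ ?_).2.differentiableAt
    · refine (lap_int h hw k).mono' (hmeas w) ?_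
      filter_upwards [ae_restrict_mem measurableSet_Ioi] with r hr using (hnorm w r hr).le
    · exact Measurable.aestronglyMeasurable (by fun_prop)
    · filter_upwards [ae_restrict_mem measurableSet_Ioi] with r hr v hv
      have hr : 0 < r := hr
      rw [← mul_assoc, norm_mul, hnorm v r hr, norm_neg, Complex.norm_real, Real.norm_of_nonneg hr.le]
      have e : r ^ (((k + 1 : ℕ) : ℝ) + lam) = r ^ (k + lam) * r := by
        rw [← Real.rpow_add_one hr.ne']; congr 1; push_cast; ring
      rw [e]
      have hre : w.re / 2 ≤ v.re := by
        have := (Complex.abs_re_le_norm (v - w)).trans (mem_ball_iff_norm.1 hv).le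
        rw [Complex.sub_re, abs_le] at this
        linarith [this.1]
      have : Real.exp (-(v.re * r)) ≤ Real.exp (-((w.re / 2) * r)) := by
        apply Real.exp_le_exp.2; nlinarith
      have h0 : 0 ≤ r ^ (k + lam) * r := by positivity
      nlinarith
    · exact lap_int h (by positivity) (k + 1)
    · refine Filter.Eventually.of_forall fun r v _ => ?_
      refine HasDerivAt.const_mul _ (HasDerivAt.cexp ?_)
      have := ((hasDerivAt_id v).mul_const (r:ℂ)).neg
      rw [one_mul] at this
      exact this
  have h2 : AnalyticOnNhd ℂ (fun w : ℂ => (1 / w) ^ ((k + lam + 1 : ℝ) : ℂ) * (Real.Gamma (k + lam + 1) : ℂ)) U := by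
    refine DifferentiableOn.analyticOnNhd (fun w hw => ?_) hUo
    have hw : 0 < w.re := hw
    have hw0 : w ≠ 0 := by rintro rfl; simp at hw
    refine DifferentiableAt.differentiableWithinAt ?_
    refine DifferentiableAt.mul_const ?_ _
    refine DifferentiableAt.cpow (by fun_prop (disch := assumption)) (by fun_prop) ?_
    left
    rw [one_div, Complex.inv_re]
    exact div_pos hw (Complex.normSq_pos.2 hw0)
  refine h1.eqOn_of_preconnected_of_frequently_eq h2 hUc (z₀ := 1) (by simp [hU]) ?_ hz
  have ht : Filter.Tendsto (fun r : ℝ => (r : ℂ)) (nhdsWithin 1 {1}ᶜ) (nhdsWithin 1 {1}ᶜ) := by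
    refine tendsto_nhdsWithin_iff.2 ⟨?_, ?_⟩
    · have := Complex.continuous_ofReal.tendsto (1:ℝ)
      rw [Complex.ofReal_one] at this
      exact this.mono_left nhdsWithin_le_nhds
    · filter_upwards [self_mem_nhdsWithin] with r hr
      have hr : r ≠ 1 := hr
      simpa using hr
  refine ht.frequently (Filter.Eventually.frequently ?_)
  have hpos : ∀ᶠ r : ℝ in nhdsWithin 1 {1}ᶜ, 0 < r :=
    nhdsWithin_le_nhds (lt_mem_nhds one_pos)
  filter_upwards [hpos] with x hx
  have := Complex.integral_cpow_mul_exp_neg_mul_Ioi (a := ((k + lam + 1 : ℝ) : ℂ)) (r := x)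
    (by rw [Complex.ofReal_re]; linarith) hx
  rw [Complex.Gamma_ofReal] at this
  rw [← this]
  refine setIntegral_congr_fun measurableSet_Ioi fun r hr => ?_
  have hr : 0 < r := hr
  rw [Complex.ofReal_cpow hr.le]
  congr 2
  push_cast; ring

lemma lap_real {lam : ℝ} (h : -(1/2 : ℝ) < lam) {x : ℝ} (hx : 0 < x) (k : ℕ) :
    ∫ r in Set.Ioi (0:ℝ), r ^ (k + lam) * Real.exp (-(x * r)) =
      (1 / x) ^ (k + lam + 1) * Real.Gamma (k + lam + 1) := by
  have hk : (0:ℝ) ≤ k := k.cast_nonneg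
  have := Real.integral_rpow_mul_exp_neg_mul_Ioi (a := k + lam + 1) (r := x) (by linarith) hx
  simpa using this

/-- coefficient of the normalised Bessel function -/
def jc (lam : ℝ) (α : ℂ) (k : ℕ) : ℂ := (-α) ^ k / ((dd lam (2 * k) : ℝ) : ℂ)

lemma laplace {lam : ℝ} (h : -(1/2 : ℝ) < lam) (α : ℂ) {z : ℂ} (hz : 0 < z.re) :
    ∫ r in Set.Ioi (0:ℝ), (∑' k, jc lam α k * ((r ^ k : ℝ) : ℂ)) * (((r ^ lam : ℝ) : ℂ) * Complex.exp (-(z * r))) =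
      (Real.Gamma (lam + 1) : ℂ) * (1 / z) ^ ((lam + 1 : ℝ) : ℂ) * Complex.exp (-α / (4 * z)) := by
  have hz0 : z ≠ 0 := by rintro rfl; simp at hz
  have hG : 0 < Real.Gamma (lam + 1) := Real.Gamma_pos_of_pos (by linarith)
  set F : ℕ → ℝ → ℂ := fun k r => jc lam α k * (((r ^ (k + lam) : ℝ) : ℂ) * Complex.exp (-(z * r))) with hF
  have hn : ∀ k, ∀ r ∈ Set.Ioi (0:ℝ), ‖F k r‖ = ‖jc lam α k‖ * (r ^ (k + lam) * Real.exp (-(z.re * r))) := by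
    intro k r hr
    have hr : 0 < r := hr
    rw [hF]; simp only
    rw [norm_mul, norm_mul, Complex.norm_real, Real.norm_of_nonneg (by positivity), Complex.norm_exp]
    simp
  have hIntg : ∀ k, Integrable (F k) (volume.restrict (Set.Ioi 0)) := by
    intro k
    refine ((lap_int h hz k).const_mul ‖jc lam α k‖).mono' ?_ ?_
    · refine Measurable.aestronglyMeasurable ?_
      rw [hF]; fun_prop
    · filter_upwards [ae_restrict_mem measurableSet_Ioi] with r hr using (hn k r hr).le
  have hratio : ∀ k : ℕ, (Real.Gamma (k + lam + 1)) / dd lam (2 * k) = Real.Gamma (lam + 1) / (4 ^ k * k.factorial) := by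
    intro k
    have := dd_gamma h k
    have h1 := dd_pos h (2 * k)
    rw [div_eq_div_iff h1.ne' (by positivity)]
    linarith
  have hs := hasSum_integral_of_summable_integral_norm hIntg ?_
  · have e1 : ∀ k, ∫ r in Set.Ioi (0:ℝ), F k r =
        (Real.Gamma (lam + 1) : ℂ) * (1 / z) ^ ((lam + 1 : ℝ) : ℂ) * ((-α / (4 * z)) ^ k / (k.factorial : ℂ)) := by
      intro k
      rw [hF]; simp only
      rw [integral_const_mul, lap_term h hz, jc]
      have e2 : (1 / z) ^ ((k + lam + 1 : ℝ) : ℂ) = (1 / z) ^ k * (1 / z) ^ ((lam + 1 : ℝ) : ℂ) := by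
        rw [← Complex.cpow_natCast, ← Complex.cpow_add _ _ (by simpa using hz0)]
        congr 1; push_cast; ring
      have e3 := congrArg (fun x : ℝ => (x : ℂ)) (hratio k)
      simp only [Complex.ofReal_div, Complex.ofReal_mul, Complex.ofReal_pow, Complex.ofReal_natCast] at e3
      rw [e2, div_mul_eq_mul_div, mul_div_assoc, mul_div_assoc, e3]
      simp only [div_pow, mul_pow, one_pow]
      push_cast
      field_simp
    have e4 := (Complex.exp_eq_exp_ℂ ▸ NormedSpace.expSeries_div_hasSum_exp (-α / (4 * z)) :
      HasSum (fun k : ℕ => (-α / (4 * z)) ^ k / (k.factorial : ℂ)) (Complex.exp (-α / (4 * z))))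
    have e5 := e4.mul_left ((Real.Gamma (lam + 1) : ℂ) * (1 / z) ^ ((lam + 1 : ℝ) : ℂ))
    have e6 := hs.unique (hs_congr e1 e5)
    rw [← e6]
    refine setIntegral_congr_fun measurableSet_Ioi fun r hr => ?_
    have hr : 0 < r := hr
    rw [← tsum_mul_right]
    refine tsum_congr fun k => ?_
    rw [hF]; simp only
    rw [Real.rpow_add hr, Real.rpow_natCast]
    push_cast; ring
  · have e1 : ∀ k, ∫ r in Set.Ioi (0:ℝ), ‖F k r‖ =
        (Real.Gamma (lam + 1)) * (1 / z.re) ^ (lam + 1) * ((‖α‖ / (4 * z.re)) ^ k / k.factorial) := by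
      intro k
      rw [setIntegral_congr_fun measurableSet_Ioi (hn k), integral_const_mul, lap_real h hz, jc,
        norm_div, norm_pow, norm_neg, Complex.norm_real, Real.norm_of_nonneg (dd_pos h _).le]
      have e2 : (1 / z.re) ^ (k + lam + 1) = (1 / z.re) ^ k * (1 / z.re) ^ (lam + 1) := by
        rw [← Real.rpow_natCast, ← Real.rpow_add (by positivity)]
        congr 1; ring
      rw [e2, div_mul_eq_mul_div, mul_div_assoc, mul_div_assoc, hratio]
      simp only [div_pow, mul_pow, one_pow]
      field_simp
    simp_rw [e1]
    exact (Real.summable_pow_div_factorial _).mul_left _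

lemma alpha_bound {lam : ℝ} (h : -(1/2 : ℝ) < lam) {α : ℂ} {B : ℝ}
    (hα : ∀ r : ℝ, 0 ≤ r → ‖∑' k, jc lam α k * ((r ^ k : ℝ) : ℂ)‖ ≤ B) {z : ℂ} (hz : 0 < z.re) :
    Real.exp ((-α / (4 * z)).re) ≤ B * (‖z‖ / z.re) ^ (lam + 1) := by
  have hz0 : z ≠ 0 := by rintro rfl; simp at hz
  have hzn : 0 < ‖z‖ := norm_pos_iff.2 hz0
  have hG : 0 < Real.Gamma (lam + 1) := Real.Gamma_pos_of_pos (by linarith)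
  have h1 := congrArg norm (laplace h α hz)
  have hreal := lap_real h hz 0
  have hrint := lap_int h hz 0
  simp only [Nat.cast_zero, zero_add] at hreal hrint
  have h2 : ‖∫ r in Set.Ioi (0:ℝ), (∑' k, jc lam α k * ((r ^ k : ℝ) : ℂ)) *
      (((r ^ lam : ℝ) : ℂ) * Complex.exp (-(z * r)))‖ ≤
      ∫ r in Set.Ioi (0:ℝ), B * (r ^ lam * Real.exp (-(z.re * r))) := by
    refine norm_integral_le_of_norm_le (hrint.const_mul B) ?_
    filter_upwards [ae_restrict_mem measurableSet_Ioi] with r hr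
    have hr : 0 < r := hr
    rw [norm_mul, norm_mul, Complex.norm_real, Real.norm_of_nonneg (by positivity), Complex.norm_exp]
    have e : (-(z * (r:ℂ))).re = -(z.re * r) := by simp
    rw [e]
    exact mul_le_mul_of_nonneg_right (hα r hr.le) (by positivity)
  rw [integral_const_mul, hreal, h1, norm_mul, norm_mul, Complex.norm_exp, Complex.norm_real,
    Real.norm_of_nonneg hG.le] at h2
  have h3 : ‖(1 / z) ^ ((lam + 1 : ℝ) : ℂ)‖ = (1 / ‖z‖) ^ (lam + 1) := by
    rw [Complex.norm_cpow_real, norm_div, norm_one]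
  rw [h3] at h2
  have h4 : (‖z‖ / z.re) ^ (lam + 1) = (1 / z.re) ^ (lam + 1) / (1 / ‖z‖) ^ (lam + 1) := by
    rw [← Real.div_rpow (by positivity) (by positivity)]
    congr 1
    field_simp
  rw [h4, ← mul_div_assoc, le_div_iff₀ (by positivity)]
  nlinarith

theorem alpha_nonneg {lam : ℝ} (h : -(1/2 : ℝ) < lam) {α : ℂ} {B : ℝ}
    (hα : ∀ r : ℝ, 0 ≤ r → ‖∑' k, jc lam α k * ((r ^ k : ℝ) : ℂ)‖ ≤ B) :
    α.im = 0 ∧ 0 ≤ α.re := by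
  have key : ∀ y : ℝ, 0 ≤ α.re - y * α.im := by
    intro y
    by_contra hneg
    push Not at hneg
    have hb : ∀ ρ : ℝ, 0 < ρ → Real.exp (ρ * (-(α.re - y * α.im) / 4)) ≤
        B * (Real.sqrt (1 + y ^ 2)) ^ (lam + 1) := by
      intro ρ hρ
      set ζ : ℂ := ρ * (1 + y * Complex.I) with hζ
      have hζre : ζ.re = ρ := by rw [hζ]; simp
      have hζ0 : ζ ≠ 0 := by intro h0; rw [h0] at hζre; simp at hζre; linarith
      have hN : Complex.normSq ζ = ρ ^ 2 * (1 + y ^ 2) := by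
        rw [hζ, Complex.normSq_apply]; simp; ring
      have hpos : 0 < 1 + y ^ 2 := by positivity
      have hzre : (ζ⁻¹).re = 1 / (ρ * (1 + y ^ 2)) := by
        rw [Complex.inv_re, hζre, hN]; field_simp
      have hnorm : ‖ζ⁻¹‖ / (ζ⁻¹).re = Real.sqrt (1 + y ^ 2) := by
        rw [hzre, norm_inv]
        have : ‖ζ‖ = ρ * Real.sqrt (1 + y ^ 2) := by
          rw [Complex.norm_def, hN, Real.sqrt_mul (by positivity), Real.sqrt_sq hρ.le]
        rw [this]
        have hs := Real.sq_sqrt hpos.le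
        have hs0 := Real.sqrt_pos.2 hpos
        field_simp
        linarith
      have := alpha_bound h hα (z := ζ⁻¹) (by rw [hzre]; positivity)
      rw [hnorm] at this
      refine le_trans (le_of_eq ?_) this
      congr 1
      have : -α / (4 * ζ⁻¹) = ((ρ / 4 : ℝ) : ℂ) * (-(α * (1 + y * Complex.I))) := by
        rw [hζ]; field_simp
        rw [hζ] at hζ0
        push_cast
        field_simp
      rw [this, Complex.re_ofReal_mul]
      simp
      ring
    set c := -(α.re - y * α.im) / 4 with hc
    have hcpos : 0 < c := by rw [hc]; linarith
    set D := B * (Real.sqrt (1 + y ^ 2)) ^ (lam + 1)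
    have := hb ((|D| + 1) / c) (by positivity)
    rw [div_mul_cancel₀ _ hcpos.ne'] at this
    have h2 := Real.add_one_le_exp (|D| + 1)
    have := le_abs_self D
    linarith
  have h0 := key 0
  refine ⟨?_, by simpa using h0⟩
  by_contra him
  have := key ((α.re + 1) / α.im)
  rw [div_mul_cancel₀ _ him] at this
  linarith

/-- coefficient of the symmetric difference -/
def cs (m : ℕ) (s : ℤ) : ℝ := (-1 : ℝ) ^ s * (Nat.choose (2 * m) ((m : ℤ) - s).toNat : ℝ)

/-- moments of the symmetric difference -/
def wt (m k : ℕ) : ℝ := ∑ s ∈ Finset.Icc (-(m : ℤ)) (m : ℤ), cs m s * (s : ℝ) ^ (2 * k)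

lemma sum_reindex {M : Type*} [AddCommMonoid M] (m : ℕ) (g : ℤ → M) :
    ∑ s ∈ Finset.Icc (-(m : ℤ)) (m : ℤ), g s = ∑ j ∈ Finset.range (2 * m + 1), g ((m : ℤ) - j) := by
  refine Finset.sum_bij' (fun s _ => ((m : ℤ) - s).toNat) (fun j _ => (m : ℤ) - j) ?_ ?_ ?_ ?_ ?_
  · intro s hs; rw [Finset.mem_Icc] at hs; rw [Finset.mem_range]; omega
  · intro j hj; rw [Finset.mem_range] at hj; rw [Finset.mem_Icc]; omega
  · intro s hs; rw [Finset.mem_Icc] at hs; omega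
  · intro j hj; omega
  · intro s hs; rw [Finset.mem_Icc] at hs; congr 1; omega

lemma cs_sub (m j : ℕ) : cs m ((m : ℤ) - j) = (-1) ^ m * (-1) ^ j * (Nat.choose (2 * m) j : ℝ) := by
  unfold cs
  rw [show ((m : ℤ) - ((m : ℤ) - j)).toNat = j by omega, zpow_sub₀ (by norm_num), zpow_natCast, zpow_natCast]
  congr 1
  rw [div_eq_iff (by simp), mul_assoc, ← pow_add, ← two_mul, pow_mul]; norm_num

lemma cs_cos (m : ℕ) (θ : ℝ) :
    ∑ s ∈ Finset.Icc (-(m : ℤ)) (m : ℤ), cs m s * Real.cos (s * θ) = (2 - 2 * Real.cos θ) ^ m := by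
  rw [sum_reindex]
  simp_rw [cs_sub]
  set z := Complex.exp (θ * Complex.I) with hz
  have hz0 : z ≠ 0 := Complex.exp_ne_zero _
  have hcz : z + z⁻¹ = ((2 * Real.cos θ : ℝ) : ℂ) := by
    rw [hz, ← Complex.exp_neg]; push_cast; rw [Complex.two_cos]; congr 2; ring
  have key : ∑ j ∈ Finset.range (2 * m + 1), (((-1) ^ m * (-1) ^ j * (Nat.choose (2 * m) j : ℝ) : ℝ) : ℂ) *
      Complex.exp (((((m : ℤ) - j : ℤ) : ℝ) * θ : ℝ) * Complex.I) = (((2 - 2 * Real.cos θ) ^ m : ℝ) : ℂ) := by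
    have e : ∀ j : ℕ, Complex.exp (((((m : ℤ) - j : ℤ) : ℝ) * θ : ℝ) * Complex.I) = z ^ m * (z⁻¹) ^ j := by
      intro j
      rw [hz, ← Complex.exp_neg, ← Complex.exp_nat_mul, ← Complex.exp_nat_mul, ← Complex.exp_add]
      congr 1; push_cast; ring
    simp_rw [e]
    have e2 : (((2 - 2 * Real.cos θ) ^ m : ℝ) : ℂ) = (-z) ^ m * (-z⁻¹ + 1) ^ (2 * m) := by
      rw [pow_mul, ← mul_pow]
      push_cast
      congr 1
      have : -z * (-z⁻¹ + 1) ^ 2 = 2 - (z + z⁻¹) := by field_simp; ring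
      rw [this, hcz]; push_cast; ring
    rw [e2, add_pow, Finset.mul_sum]
    refine Finset.sum_congr rfl fun j _ => ?_
    rw [one_pow, neg_pow z, neg_pow z⁻¹]
    push_cast; ring
  have := congrArg Complex.re key
  rw [Complex.ofReal_re, Complex.re_sum] at this
  rw [← this]
  refine Finset.sum_congr rfl fun j _ => ?_
  rw [Complex.re_ofReal_mul, Complex.exp_ofReal_mul_I_re]

lemma wt_fwd (m k : ℕ) : wt m k = (-1) ^ m * (fwdDiff (1:ℝ))^[2 * m] (fun x : ℝ => x ^ (2 * k)) (-(m:ℝ)) := by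
  rw [fwdDiff_iter_eq_sum_shift, wt, sum_reindex, Finset.mul_sum]
  refine Finset.sum_congr rfl fun j hj => ?_
  rw [Finset.mem_range] at hj
  rw [cs_sub]
  have : ((-1 : ℤ) ^ (2 * m - j)) = (-1) ^ j := by
    have h1 : (-1 : ℤ) ^ (2 * m - j) * (-1) ^ j = 1 := by
      rw [← pow_add, Nat.sub_add_cancel (by omega), pow_mul]; norm_num
    have h2 : (-1 : ℤ) ^ j * (-1) ^ j = 1 := by rw [← mul_pow]; norm_num
    exact mul_right_cancel₀ (by simp) (h1.trans h2.symm)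
  rw [this]
  simp only [zsmul_eq_mul, nsmul_eq_mul, mul_one]
  push_cast
  have : (-(m:ℝ) + j) ^ (2 * k) = ((m:ℝ) - j) ^ (2 * k) := by
    rw [pow_mul, pow_mul]; congr 1; ring
  rw [this]; ring

lemma wt_lt {m k : ℕ} (hk : k < m) : wt m k = 0 := by
  rw [wt_fwd, fwdDiff_iter_pow_eq_zero_of_lt (by omega)]; simp

lemma wt_self (m : ℕ) : wt m m ≠ 0 := by
  rw [wt_fwd, fwdDiff_iter_eq_factorial]
  simp [Nat.factorial_ne_zero]

lemma wt_bound (m : ℕ) : ∃ W : ℝ, 0 ≤ W ∧ ∀ k, |wt m k| ≤ W * ((m:ℝ) ^ 2) ^ k := by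
  refine ⟨∑ s ∈ Finset.Icc (-(m : ℤ)) (m : ℤ), |cs m s|, by positivity, fun k => ?_⟩
  rw [wt, Finset.sum_mul]
  refine (Finset.abs_sum_le_sum_abs _ _).trans (Finset.sum_le_sum fun s hs => ?_)
  rw [Finset.mem_Icc] at hs
  rw [abs_mul, pow_mul, abs_of_nonneg (a := ((s:ℝ) ^ 2) ^ k) (by positivity)]
  gcongr ?_ * ?_ ^ k
  have h1 : -(m:ℝ) ≤ s := by exact_mod_cast hs.1
  have h2 : (s:ℝ) ≤ m := by exact_mod_cast hs.2
  exact sq_le_sq' h1 h2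

lemma cos_moment {lam : ℝ} (h : -(1/2 : ℝ) < lam) (k : ℕ) :
    ∫ φ in Set.Ioo 0 π, Real.cos φ ^ (2 * k) * ww lam φ =
      kap lam * (2 * k).factorial / dd lam (2 * k) := by
  induction k with
  | zero => simp [dd, kap]
  | succ k ih =>
    have hp := parts h (fun φ => Real.cos φ ^ (2 * k + 1))
      (fun φ => (2 * k + 1 : ℕ) * Real.cos φ ^ (2 * k) * (-Real.sin φ))
      (fun φ => (Real.hasDerivAt_cos φ).pow (2 * k + 1)) (by fun_prop)
    have e : ∀ φ, ((2 * lam + 1) * Real.cos φ * Real.cos φ ^ (2 * k + 1) + Real.sin φ *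
        ((2 * k + 1 : ℕ) * Real.cos φ ^ (2 * k) * (-Real.sin φ))) * ww lam φ =
        (2 * k + 2 * lam + 2) * (Real.cos φ ^ (2 * (k + 1)) * ww lam φ) -
          (2 * k + 1) * (Real.cos φ ^ (2 * k) * ww lam φ) := by
      intro φ
      have := Real.sin_sq φ
      push_cast
      linear_combination (-(2 * (k:ℝ) + 1) * Real.cos φ ^ (2 * k) * ww lam φ) * this
    simp_rw [e] at hp
    rw [integral_sub ((cont_ww_int h (by fun_prop)).const_mul _) ((cont_ww_int h (by fun_prop)).const_mul _),
      integral_const_mul, integral_const_mul, ih] at hp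
    have h1 := dd_pos h (2 * k)
    have hk : (0:ℝ) ≤ k := k.cast_nonneg
    have h2 : 0 < 2 * (k:ℝ) + 2 * lam + 2 := by linarith
    rw [dd_even, dd_odd, show 2 * (k + 1) = 2 * k + 1 + 1 by ring, Nat.factorial_succ, Nat.factorial_succ]
    rw [show 2 * k + 1 + 1 = 2 * (k + 1) by ring]
    have h3 := h1.ne'
    have h4 := h2.ne'
    have h5 : 2 * (k:ℝ) + 2 ≠ 0 := by positivity
    rw [sub_eq_zero] at hp
    apply mul_left_cancel₀ h4
    rw [hp]
    push_cast
    generalize 2 * (k:ℝ) + 2 * lam + 2 = y at h4 ⊢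
    field_simp

lemma hs_congr' {f g : ℕ → ℝ} {a b : ℝ} (hfg : ∀ j, f j = g j) (hab : a = b) (hg : HasSum g b) : HasSum f a := by
  rw [hab, funext hfg]; exact hg

lemma bessel_sum {lam : ℝ} (h : -(1/2 : ℝ) < lam) (v : ℝ) :
    HasSum (fun k : ℕ => (-1) ^ k * v ^ (2 * k) / dd lam (2 * k))
      ((kap lam)⁻¹ * ∫ φ in Set.Ioo 0 π, Real.cos (v * Real.cos φ) * ww lam φ) := by
  have hkap := kap_pos h
  set F : ℕ → ℝ → ℝ := fun k φ => ((-1) ^ k * v ^ (2 * k) / (2 * k).factorial) * (Real.cos φ ^ (2 * k) * ww lam φ) with hF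
  have hIntg : ∀ k, Integrable (F k) (volume.restrict (Set.Ioo 0 π)) := fun k =>
    (cont_ww_int h (by fun_prop)).const_mul _
  have hsum : Summable fun k : ℕ => v ^ (2 * k) / dd lam (2 * k) := by
    refine Summable.of_nonneg_of_le (fun k => div_nonneg (by rw [pow_mul]; positivity) (dd_pos h _).le) (fun k => ?_)
      ((Real.summable_pow_div_factorial v).comp_injective (i := fun k : ℕ => 2 * k) (fun a b hab => by simpa using hab))
    simp only [Function.comp]
    have : 0 ≤ v ^ (2 * k) := by rw [pow_mul]; positivity
    exact div_le_div_of_nonneg_left this (by positivity) (dd_ge h _)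
  have hs := hasSum_integral_of_summable_integral_norm hIntg ?_
  · have e1 : ∀ k, ∫ φ in Set.Ioo 0 π, F k φ = kap lam * ((-1) ^ k * v ^ (2 * k) / dd lam (2 * k)) := by
      intro k
      rw [hF]; simp only
      rw [integral_const_mul, cos_moment h]
      have := (dd_pos h (2 * k)).ne'
      field_simp
    simp_rw [e1] at hs
    have := hs.mul_left (kap lam)⁻¹
    simp_rw [inv_mul_cancel_left₀ hkap.ne'] at this
    have e2 : (fun φ => Real.cos (v * Real.cos φ) * ww lam φ) = fun φ => ∑' i, F i φ := by
      funext φ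
      rw [hF]
      have this := (Real.hasSum_cos (v * Real.cos φ)).mul_right (ww lam φ)
      rw [← this.tsum_eq]
      refine tsum_congr fun k => ?_
      rw [mul_pow]; ring
    rw [e2]
    exact this
  · refine (hsum.mul_left (kap lam)).congr fun k => ?_
    have : ∀ φ ∈ Set.Ioo 0 π, ‖F k φ‖ = (v ^ (2 * k) / (2 * k).factorial) * (Real.cos φ ^ (2 * k) * ww lam φ) := by
      intro φ hφ
      have h1 : 0 ≤ v ^ (2 * k) := by rw [pow_mul]; positivity
      have h2 : 0 ≤ Real.cos φ ^ (2 * k) := by rw [pow_mul]; positivity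
      have h3 : 0 ≤ ww lam φ := Real.rpow_nonneg (Real.sin_pos_of_mem_Ioo hφ).le _
      rw [hF]; simp only
      rw [norm_mul, norm_div, norm_mul, norm_pow, norm_neg, norm_one, one_pow, one_mul,
        Real.norm_of_nonneg h1, Real.norm_of_nonneg (mul_nonneg h2 h3), Real.norm_of_nonneg (by positivity)]
    rw [setIntegral_congr_fun measurableSet_Ioo this, integral_const_mul, cos_moment h]
    have := (dd_pos h (2 * k)).ne'
    field_simp

lemma int_pos {lam : ℝ} (h : -(1/2 : ℝ) < lam) {u : ℝ} (hu : 0 < u) (m : ℕ) :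
    0 < ∫ φ in Set.Ioo 0 π, (2 - 2 * Real.cos (u * Real.cos φ)) ^ m * ww lam φ := by
  have hnn : ∀ φ, 0 ≤ (2 - 2 * Real.cos (u * Real.cos φ)) := fun φ => by
    linarith [Real.cos_le_one (u * Real.cos φ)]
  rw [setIntegral_pos_iff_support_of_nonneg_ae]
  · set O : Set ℝ := {φ | 0 < Real.cos φ ∧ u * Real.cos φ < 2 * π} ∩ Set.Ioo 0 π with hO
    have hOo : IsOpen O := by
      refine IsOpen.inter ?_ isOpen_Ioo
      exact (isOpen_lt continuous_const Real.continuous_cos).inter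
        (isOpen_lt (continuous_const.mul Real.continuous_cos) continuous_const)
    have hne : O.Nonempty := by
      have hmin : 0 < min (1/2) (1/u) := by positivity
      have hmin2 : min (1/2) (1/u) < 1 := lt_of_le_of_lt (min_le_left _ _) (by norm_num)
      refine ⟨Real.arccos (min (1/2) (1/u)), ⟨?_, ?_⟩, ?_, ?_⟩
      · rw [Real.cos_arccos (by linarith) hmin2.le]; exact hmin
      · rw [Real.cos_arccos (by linarith) hmin2.le]
        have : u * min (1/2) (1/u) ≤ u * (1/u) := mul_le_mul_of_nonneg_left (min_le_right _ _) hu.le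
        rw [mul_one_div_cancel hu.ne'] at this
        linarith [Real.pi_gt_three]
      · exact Real.arccos_pos.2 hmin2
      · have := Real.arccos_lt_pi_div_two.2 hmin
        linarith [Real.pi_pos]
    refine lt_of_lt_of_le (hOo.measure_pos volume hne) (measure_mono ?_)
    rintro φ ⟨⟨h1, h2⟩, h3⟩
    refine ⟨?_, h3⟩
    have hs : 0 < ww lam φ := Real.rpow_pos_of_pos (Real.sin_pos_of_mem_Ioo h3) _
    have hc : Real.cos (u * Real.cos φ) ≠ 1 := by
      intro hc
      have := (Real.cos_eq_one_iff_of_lt_of_lt (x := u * Real.cos φ) (by nlinarith [Real.pi_pos, mul_pos hu h1]) h2).1 hc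
      exact (mul_pos hu h1).ne' this
    have hlt := lt_of_le_of_ne (Real.cos_le_one _) hc
    have : 0 < (2 - 2 * Real.cos (u * Real.cos φ)) := by linarith
    exact (mul_pos (pow_pos this m) hs).ne'
  · filter_upwards [ae_restrict_mem measurableSet_Ioo] with φ hφ
    exact mul_nonneg (pow_nonneg (hnn φ) _) (Real.rpow_nonneg (Real.sin_pos_of_mem_Ioo hφ).le _)
  · exact cont_ww_int h (by fun_prop)

/-- coefficients of the symbol -/
def psi (lam : ℝ) (m k : ℕ) : ℝ := (-1) ^ k * (wt m (k + m) / dd lam (2 * (k + m)))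

lemma psi_summable {lam : ℝ} (h : -(1/2 : ℝ) < lam) (m : ℕ) (r : ℝ) (hr : 0 ≤ r) :
    Summable fun k => |psi lam m k| * r ^ k := by
  obtain ⟨W, hW, hb⟩ := wt_bound m
  refine Summable.of_nonneg_of_le (fun k => by positivity) (fun k => ?_)
    ((Real.summable_pow_div_factorial ((m:ℝ) ^ 2 * r)).mul_left (W * ((m:ℝ) ^ 2) ^ m))
  rw [psi, abs_mul, abs_pow, abs_neg, abs_one, one_pow, one_mul, abs_div, abs_of_pos (dd_pos h _)]
  have h1 : (k.factorial : ℝ) ≤ dd lam (2 * (k + m)) :=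
    le_trans (by exact_mod_cast Nat.factorial_le (by omega)) (dd_ge h _)
  have h2 : |wt m (k + m)| / dd lam (2 * (k + m)) ≤ (W * ((m:ℝ) ^ 2) ^ (k + m)) / k.factorial :=
    div_le_div₀ (by positivity) (hb _) (by positivity) h1
  calc _ ≤ (W * ((m:ℝ) ^ 2) ^ (k + m)) / k.factorial * r ^ k := by gcongr
    _ = _ := by rw [pow_add, mul_pow]; ring

theorem psi_ne {lam : ℝ} (h : -(1/2 : ℝ) < lam) (m : ℕ) {x : ℝ} (hx : 0 ≤ x) :
    ∑' k, psi lam m k * x ^ k ≠ 0 := by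
  rcases hx.eq_or_lt with rfl | hx
  · rw [tsum_eq_single 0]
    · simp [psi, wt_self, (dd_pos h (2 * m)).ne']
    · intro k hk; simp [hk]
  · obtain ⟨u, hu, rfl⟩ : ∃ u, 0 < u ∧ x = u ^ 2 := ⟨Real.sqrt x, Real.sqrt_pos.2 hx, (Real.sq_sqrt hx.le).symm⟩
    have h1 : HasSum (fun k : ℕ => (-1) ^ k * wt m k * u ^ (2 * k) / dd lam (2 * k))
        ((kap lam)⁻¹ * ∫ φ in Set.Ioo 0 π, (2 - 2 * Real.cos (u * Real.cos φ)) ^ m * ww lam φ) := by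
      have := hasSum_sum (s := Finset.Icc (-(m : ℤ)) (m : ℤ)) (fun s _ => (bessel_sum h (s * u)).mul_left (cs m s))
      refine hs_congr' ?_ ?_ this
      · intro k
        rw [wt, Finset.mul_sum, Finset.sum_mul, Finset.sum_div]
        refine Finset.sum_congr rfl fun s _ => ?_
        rw [mul_pow]; ring
      · simp_rw [mul_left_comm (cs m _) (kap lam)⁻¹]
        rw [← Finset.mul_sum]
        congr 1
        simp_rw [← integral_const_mul]
        rw [← integral_finsetSum]
        · refine integral_congr_ae (Filter.Eventually.of_forall fun φ => ?_)
          simp only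
          rw [← cs_cos, Finset.sum_mul]
          refine Finset.sum_congr rfl fun s _ => ?_
          rw [mul_assoc, mul_assoc]
        · intro s _
          exact (cont_ww_int h (by fun_prop)).const_mul _
    have h2 := (hasSum_nat_add_iff' m).2 h1
    rw [Finset.sum_eq_zero, sub_zero] at h2
    · have h3 : ∀ k, (-1) ^ (k + m) * wt m (k + m) * u ^ (2 * (k + m)) / dd lam (2 * (k + m)) =
          ((-1) ^ m * (u ^ 2) ^ m) * (psi lam m k * (u ^ 2) ^ k) := by
        intro k
        rw [psi, pow_mul, pow_add, pow_add]; ring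
      simp_rw [h3] at h2
      have h4 := h2.tsum_eq
      rw [tsum_mul_left] at h4
      intro h0
      rw [h0, mul_zero] at h4
      have := mul_pos (inv_pos.2 (kap_pos h)) (int_pos h hu m)
      linarith
    · intro k hk
      rw [wt_lt (Finset.mem_range.1 hk)]; simp

open UniformSpace in
lemma core {lam : ℝ} (h : -(1/2 : ℝ) < lam) {A : Type*} [SeminormedCommRing A] [NormedAlgebra ℂ A]
    (h1 : ‖(1:A)‖ ≤ 1) (x : A) {M : ℝ} (hM : ‖x‖ ≤ M) (R : ℝ → ℕ → ℝ)
    (hR : ∀ r, 0 ≤ r → Filter.Tendsto (R r) Filter.atTop (nhds 0))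
    (hx : ∀ r, 0 ≤ r → ∀ N, ‖∑ k ∈ Finset.range N, (((-1) ^ k * r ^ k / dd lam (2 * k) : ℝ) : ℂ) • x ^ k‖ ≤ 2 + R r N)
    (ψ : ℕ → ℝ) (hψ : Summable fun k => |ψ k| * M ^ k) (hψ0 : ∀ y, 0 ≤ y → ∑' k, ψ k * y ^ k ≠ 0) :
    ∃ q : A, ∃ N₁, ∀ N ≥ N₁, ‖(∑ k ∈ Finset.range N, ((ψ k : ℝ) : ℂ) • x ^ k) * q - 1‖ ≤ 1 / 2 := by
  have hM0 : 0 ≤ M := (norm_nonneg _).trans hM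
  set X : Completion A := (x : Completion A) with hX
  have hXM : ‖X‖ ≤ M := by rw [hX, Completion.norm_coe]; exact hM
  have hB1 : ‖(1 : Completion A)‖ ≤ 1 := by
    rw [← Completion.coe_one, Completion.norm_coe]; exact h1
  have hXp : ∀ k, ‖X ^ k‖ ≤ M ^ k := by
    intro k
    induction k with
    | zero => simpa using hB1
    | succ k ih =>
      rw [pow_succ, pow_succ]
      exact (norm_mul_le _ _).trans (mul_le_mul ih hXM (norm_nonneg _) (by positivity))
  have hcoe : ∀ (N : ℕ) (c : ℕ → ℂ), ((∑ k ∈ Finset.range N, c k • x ^ k : A) : Completion A) =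
      ∑ k ∈ Finset.range N, c k • X ^ k := by
    intro N c
    have := map_sum (Completion.toComplₗᵢ (𝕜 := ℂ) (E := A)) (fun k => c k • x ^ k) (Finset.range N)
    simp only [map_smul, Completion.coe_toComplₗᵢ] at this
    rw [this]
    refine Finset.sum_congr rfl fun k _ => ?_
    congr 1
    exact map_pow (Completion.coeRingHom : A →+* Completion A) x k
  have hsum : Summable fun k => ((ψ k : ℝ) : ℂ) • X ^ k := by
    refine Summable.of_norm_bounded hψ fun k => ?_
    rw [norm_smul, Complex.norm_real, Real.norm_eq_abs]
    exact mul_le_mul_of_nonneg_left (hXp k) (abs_nonneg _)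
  set Y := ∑' k, ((ψ k : ℝ) : ℂ) • X ^ k with hY
  have hunit : IsUnit Y := by
    by_contra hnu
    obtain ⟨χ, hχ⟩ := WeakDual.CharacterSpace.exists_apply_eq_zero hnu
    set α : ℂ := χ X with hα
    have hnorm : ∀ a, ‖χ a‖ ≤ ‖a‖ := fun a => by
      refine (AlgHom.norm_apply_le_self_mul_norm_one χ a).trans ?_
      exact mul_le_of_le_one_right (norm_nonneg _) hB1
    have hb : ∀ r : ℝ, 0 ≤ r → ‖∑' k, jc lam α k * ((r ^ k : ℝ) : ℂ)‖ ≤ 2 := by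
      intro r hr
      have hs : Summable fun k => jc lam α k * ((r ^ k : ℝ) : ℂ) := by
        refine Summable.of_norm_bounded (Real.summable_pow_div_factorial (‖α‖ * r)) fun k => ?_
        rw [jc, norm_mul, norm_div, norm_pow, norm_neg, Complex.norm_real, Complex.norm_real,
          Real.norm_of_nonneg (dd_pos h _).le, Real.norm_of_nonneg (by positivity), mul_pow, div_mul_eq_mul_div]
        refine div_le_div_of_nonneg_left (by positivity) (by positivity) ?_
        exact le_trans (by exact_mod_cast Nat.factorial_le (by omega)) (dd_ge h _)
      have ht := hs.hasSum.tendsto_sum_nat.norm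
      have ht2 : Filter.Tendsto (fun N => 2 + R r N) Filter.atTop (nhds 2) := by
        simpa using (hR r hr).const_add 2
      refine le_of_tendsto_of_tendsto' ht ht2 fun N => ?_
      refine le_trans ?_ (hx r hr N)
      rw [← Completion.norm_coe (E := A), hcoe]
      refine le_trans (le_of_eq ?_) (hnorm _)
      rw [map_sum]
      congr 1
      refine Finset.sum_congr rfl fun k _ => ?_
      rw [map_smul, map_pow, ← hα, jc, smul_eq_mul, neg_pow]
      push_cast; ring
    obtain ⟨him, hre⟩ := alpha_nonneg h hb
    have hαr : α = (α.re : ℂ) := Complex.ext (by simp) (by simp [him])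
    have h2 : HasSum (fun k => χ (((ψ k : ℝ) : ℂ) • X ^ k)) (χ Y) :=
      hsum.hasSum.map χ (map_continuous χ)
    rw [hχ] at h2
    have h3 : ∀ k, χ (((ψ k : ℝ) : ℂ) • X ^ k) = ((ψ k * α.re ^ k : ℝ) : ℂ) := by
      intro k
      rw [map_smul, map_pow, ← hα, smul_eq_mul]
      nth_rw 1 [hαr]
      push_cast; rfl
    simp_rw [h3] at h2
    have h4 := Complex.hasSum_ofReal.1 (by simpa using h2 : HasSum (fun k => ((ψ k * α.re ^ k : ℝ) : ℂ)) ((0:ℝ):ℂ))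
    exact hψ0 _ hre h4.tsum_eq
  obtain ⟨v, hv⟩ := hunit.exists_right_inv
  obtain ⟨q, hq⟩ : ∃ q : A, ‖Y * q - 1‖ < 1 / 2 := by
    have hc : Continuous fun w : Completion A => ‖Y * w - 1‖ := by fun_prop
    have hO : IsOpen {w : Completion A | ‖Y * w - 1‖ < 1 / 2} := isOpen_lt hc continuous_const
    obtain ⟨q, hq⟩ := Completion.denseRange_coe.exists_mem_open hO ⟨v, by simp [hv]⟩
    exact ⟨q, hq⟩
  refine ⟨q, ?_⟩
  have ht : Filter.Tendsto (fun N => ‖(∑ k ∈ Finset.range N, ((ψ k : ℝ) : ℂ) • X ^ k) * q - 1‖) Filter.atTop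
      (nhds ‖Y * q - 1‖) :=
    ((hsum.hasSum.tendsto_sum_nat.mul_const _).sub_const _).norm
  obtain ⟨N₁, hN⟩ := Filter.eventually_atTop.1 (ht.eventually_lt_const hq)
  refine ⟨N₁, fun N hNN => ?_⟩
  refine le_trans (le_of_eq ?_) (hN N hNN).le
  rw [← Completion.norm_coe, Completion.coe_sub, Completion.coe_mul, hcoe, Completion.coe_one]

section Mult
variable {R : Type*} [CommRing R] [Algebra ℂ R] (G : Set (Seminorm ℂ R))

/-- multiplier bounds -/
def MB (P : R) : Set ℝ := {C | 0 ≤ C ∧ ∀ n ∈ G, ∀ Q, n (P * Q) ≤ C * n Q}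

/-- multiplier norm -/
def MN (P : R) : ℝ := sInf (MB G P)

variable {G}

lemma MN_nonneg (P : R) : 0 ≤ MN G P := Real.sInf_nonneg fun _ hC => hC.1

lemma MN_le {P : R} {C : ℝ} (hC : C ∈ MB G P) : MN G P ≤ C :=
  csInf_le ⟨0, fun _ h => h.1⟩ hC

lemma MN_mem {P : R} (hne : (MB G P).Nonempty) : MN G P ∈ MB G P := by
  refine ⟨MN_nonneg P, fun n hn Q => ?_⟩
  rcases (apply_nonneg n Q).eq_or_lt with h0 | h0
  · obtain ⟨C, hC⟩ := hne
    have := hC.2 n hn Q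
    rw [← h0, mul_zero] at this ⊢
    exact this
  · rw [← div_le_iff₀ h0]
    refine le_csInf hne fun C hC => ?_
    rw [div_le_iff₀ h0]
    exact hC.2 n hn Q

/-- the multiplier norm as a ring seminorm -/
def MNr (hne : ∀ P, (MB G P).Nonempty) : RingSeminorm R where
  toFun := MN G
  map_zero' := le_antisymm (MN_le ⟨le_rfl, fun n _ Q => by simp⟩) (MN_nonneg _)
  add_le' P Q := by
    refine MN_le ⟨add_nonneg (MN_nonneg _) (MN_nonneg _), fun n hn S => ?_⟩
    rw [add_mul, add_mul]
    exact (map_add_le_add n _ _).trans (add_le_add ((MN_mem (hne P)).2 n hn S) ((MN_mem (hne Q)).2 n hn S))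
  neg' P := by
    have : MB G (-P) = MB G P := by
      unfold MB; ext C; simp [map_neg_eq_map]
    unfold MN; rw [this]
  mul_le' P Q := by
    refine MN_le ⟨mul_nonneg (MN_nonneg _) (MN_nonneg _), fun n hn S => ?_⟩
    rw [mul_assoc, mul_assoc]
    exact ((MN_mem (hne P)).2 n hn _).trans
      (mul_le_mul_of_nonneg_left ((MN_mem (hne Q)).2 n hn S) (MN_nonneg _))

lemma MN_smul (hne : ∀ P, (MB G P).Nonempty) (c : ℂ) (P : R) : MN G (c • P) ≤ ‖c‖ * MN G P := by
  refine MN_le ⟨mul_nonneg (norm_nonneg _) (MN_nonneg _), fun n hn S => ?_⟩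
  rw [smul_mul_assoc, map_smul_eq_mul, mul_assoc]
  exact mul_le_mul_of_nonneg_left ((MN_mem (hne P)).2 n hn S) (norm_nonneg _)

theorem core2 {lam : ℝ} (h : -(1/2 : ℝ) < lam) (hne : ∀ P, (MB G P).Nonempty)
    (x : R) {M : ℝ} (hM0 : 0 ≤ M) (hM : ∀ n ∈ G, ∀ Q, n (x * Q) ≤ M * n Q) (Rr : ℝ → ℕ → ℝ)
    (hR0 : ∀ r N, 0 ≤ r → 0 ≤ Rr r N)
    (hR : ∀ r, 0 ≤ r → Filter.Tendsto (Rr r) Filter.atTop (nhds 0))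
    (hx : ∀ r, 0 ≤ r → ∀ N, ∀ n ∈ G, ∀ Q,
      n ((∑ k ∈ Finset.range N, (((-1) ^ k * r ^ k / dd lam (2 * k) : ℝ) : ℂ) • x ^ k) * Q) ≤ (2 + Rr r N) * n Q)
    (ψ : ℕ → ℝ) (hψ : Summable fun k => |ψ k| * M ^ k) (hψ0 : ∀ y, 0 ≤ y → ∑' k, ψ k * y ^ k ≠ 0) :
    ∃ K : ℝ, 0 ≤ K ∧ ∃ N₁, ∀ N ≥ N₁, ∀ n ∈ G, n 1 ≤ K * n (∑ k ∈ Finset.range N, ((ψ k : ℝ) : ℂ) • x ^ k) := by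
  obtain ⟨q, N₁, hq⟩ : ∃ q : R, ∃ N₁, ∀ N ≥ N₁,
      MN G ((∑ k ∈ Finset.range N, ((ψ k : ℝ) : ℂ) • x ^ k) * q - 1) ≤ 1 / 2 := by
    letI I1 : SeminormedCommRing R := { (MNr hne).toSeminormedRing, (inferInstance : CommRing R) with }
    letI I2 : NormedAlgebra ℂ R := { (inferInstance : Algebra ℂ R) with norm_smul_le := MN_smul hne }
    refine core (A := R) h ?_ x (M := M) ?_ Rr hR ?_ ψ hψ hψ0
    · exact MN_le ⟨zero_le_one, fun n _ Q => by rw [one_mul, one_mul]⟩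
    · exact MN_le ⟨hM0, hM⟩
    · intro r hr N
      exact MN_le ⟨by linarith [hR0 r N hr], hx r hr N⟩
  refine ⟨2 * MN G q, mul_nonneg zero_le_two (MN_nonneg _), N₁, fun N hN n hn => ?_⟩
  set P := ∑ k ∈ Finset.range N, ((ψ k : ℝ) : ℂ) • x ^ k
  have h1 := (MN_mem (hne (P * q - 1))).2 n hn 1
  have h2 := (MN_mem (hne q)).2 n hn P
  have h3 : n 1 ≤ n (q * P) + n ((P * q - 1) * 1) := by
    have : (1 : R) = q * P - (P * q - 1) * 1 := by ring
    calc n 1 = n (q * P - (P * q - 1) * 1) := by rw [← this]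
      _ ≤ _ := map_sub_le_add n _ _
  have h4 := mul_le_mul_of_nonneg_right (hq N hN) (apply_nonneg n 1)
  linarith

end Mult

section Wsec
variable {lam : ℝ} (h : -(1/2 : ℝ) < lam) {τ : ℝ} (hτ : 0 < τ) {p : ℝ≥0∞} (hp : 1 ≤ p)

lemma Bd.add {c c' τ : ℝ} {a b : ℕ → ℂ} (ha : Bd c τ a) (hb : Bd c' τ b) : Bd (c + c') τ (a + b) := by
  intro n
  rw [add_mul]
  exact (norm_add_le _ _).trans (add_le_add (ha n) (hb n))

lemma Bd.smul {c τ : ℝ} {b : ℕ → ℂ} (hb : Bd c τ b) (z : ℂ) : Bd (‖z‖ * c) τ (z • b) := by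
  intro n
  rw [Pi.smul_apply, norm_smul, mul_assoc]
  exact mul_le_mul_of_nonneg_left (hb n) (norm_nonneg _)

lemma Fb_smul (z : ℂ) (b : ℕ → ℂ) : Fb lam (z • b) = z • Fb lam b := by
  funext x
  simp only [Fb, Pi.smul_apply, smul_eq_mul, mul_assoc]
  exact tsum_mul_left

lemma Fb_zero : Fb lam 0 = 0 := by
  funext x; simp [Fb]

lemma Fb_add {lam : ℝ} (h : -(1/2 : ℝ) < lam) {τ : ℝ} (hτ : 0 < τ) {c c' : ℝ} {a b : ℕ → ℂ} (ha : Bd c τ a) (hb : Bd c' τ b) :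
    Fb lam (a + b) = Fb lam a + Fb lam b := by
  funext x
  have := (Fb_summable h hτ.le ha x).tsum_add (Fb_summable h hτ.le hb x)
  rw [Pi.add_apply]
  unfold Fb
  rw [← this]
  simp only [Pi.add_apply, add_mul]

/-- the space of admissible coefficient sequences -/
def W : Submodule ℂ (ℕ → ℂ) where
  carrier := {b | (∃ c, Bd c τ b) ∧ eLpNorm (Fb lam b) p (μw lam) ≠ ⊤}
  zero_mem' := ⟨⟨0, fun n => by simp⟩, by rw [Fb_zero]; simp⟩
  add_mem' := by
    rintro a b ⟨⟨c, ha⟩, ha2⟩ ⟨⟨c', hb⟩, hb2⟩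
    refine ⟨⟨_, ha.add hb⟩, ?_⟩
    rw [Fb_add h hτ ha hb]
    exact ((eLpNorm_add_le (Fb_continuous h hτ.le ha).aestronglyMeasurable
      (Fb_continuous h hτ.le hb).aestronglyMeasurable hp).trans_lt
      (ENNReal.add_lt_top.2 ⟨ha2.lt_top, hb2.lt_top⟩)).ne
  smul_mem' := by
    rintro z b ⟨⟨c, hb⟩, hb2⟩
    refine ⟨⟨_, hb.smul z⟩, ?_⟩
    rw [Fb_smul, eLpNorm_const_smul]
    exact ENNReal.mul_ne_top (by simp) hb2

/-- the Bernstein constant -/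
def Ec (lam τ : ℝ) : ℝ := 2 * Real.exp 1 * dd lam 2 * τ ^ 2

lemma Ec_nonneg {lam : ℝ} (h : -(1/2 : ℝ) < lam) {τ : ℝ} : 0 ≤ Ec lam τ := by
  have := dd_pos h 2
  unfold Ec; positivity

lemma Ec_ge {lam : ℝ} (h : -(1/2 : ℝ) < lam) {τ : ℝ} : τ ^ 2 ≤ Ec lam τ := by
  have h1 := dd_ge h 2
  have h2 : (1:ℝ) ≤ Real.exp 1 := Real.one_le_exp zero_le_one
  have h3 : (1:ℝ) ≤ dd lam 2 := le_trans (by norm_num [Nat.factorial]) h1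
  unfold Ec
  have : (1:ℝ) ≤ 2 * Real.exp 1 * dd lam 2 := by nlinarith
  nlinarith [sq_nonneg τ]

/-- the shift -/
def shW : W h hτ hp →ₗ[ℂ] W h hτ hp where
  toFun v := ⟨sh 1 v.1, by
    obtain ⟨v, ⟨c, hb⟩, hf⟩ := v
    exact ⟨⟨_, hb.sh 1⟩, ((bern h hτ hb hp hf).trans_lt
      (ENNReal.mul_lt_top ENNReal.ofReal_lt_top hf.lt_top)).ne⟩⟩
  map_add' a b := rfl
  map_smul' z b := rfl

lemma shW_pow (k : ℕ) (v : W h hτ hp) : ((shW h hτ hp ^ k) v).1 = sh k v.1 := by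
  induction k generalizing v with
  | zero => rfl
  | succ k ih =>
    rw [pow_succ, Module.End.mul_apply, ih]
    funext n
    show v.1 _ = v.1 _
    congr 1

/-- the norm on `W` -/
def NW : Seminorm ℂ (W h hτ hp) := Seminorm.of (fun v => (eLpNorm (Fb lam v.1) p (μw lam)).toReal)
  (by
    rintro ⟨a, ⟨c, ha⟩, ha2⟩ ⟨b, ⟨c', hb⟩, hb2⟩
    show (eLpNorm (Fb lam (a + b)) p (μw lam)).toReal ≤ _
    rw [Fb_add h hτ ha hb, ← ENNReal.toReal_add ha2 hb2]
    exact ENNReal.toReal_mono (ENNReal.add_ne_top.2 ⟨ha2, hb2⟩)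
      (eLpNorm_add_le (Fb_continuous h hτ.le ha).aestronglyMeasurable
      (Fb_continuous h hτ.le hb).aestronglyMeasurable hp))
  (by
    rintro z ⟨b, hb⟩
    show (eLpNorm (Fb lam (z • b)) p (μw lam)).toReal = _
    rw [Fb_smul, eLpNorm_const_smul, ENNReal.toReal_mul]
    simp)

lemma NW_def (v : W h hτ hp) : NW h hτ hp v = (eLpNorm (Fb lam v.1) p (μw lam)).toReal := rfl

lemma NW_of (v : W h hτ hp) : eLpNorm (Fb lam v.1) p (μw lam) = ENNReal.ofReal (NW h hτ hp v) := by
  rw [NW_def, ENNReal.ofReal_toReal v.2.2]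

lemma NW_sh (v : W h hτ hp) : NW h hτ hp (shW h hτ hp v) ≤ Ec lam τ * NW h hτ hp v := by
  obtain ⟨v, ⟨c, hb⟩, hf⟩ := v
  have : _ ≤ ENNReal.ofReal (Ec lam τ) * _ := bern h hτ hb hp hf
  have h2 := ENNReal.toReal_mono (ENNReal.mul_ne_top ENNReal.ofReal_ne_top hf) this
  rw [ENNReal.toReal_mul, ENNReal.toReal_ofReal (Ec_nonneg h)] at h2
  exact h2

lemma NW_shk (k : ℕ) (v : W h hτ hp) :
    NW h hτ hp ((shW h hτ hp ^ k) v) ≤ Ec lam τ ^ k * NW h hτ hp v := by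
  induction k with
  | zero => simp
  | succ k ih =>
    rw [pow_succ', Module.End.mul_apply]
    refine (NW_sh h hτ hp _).trans ?_
    rw [pow_succ', mul_assoc]
    exact mul_le_mul_of_nonneg_left ih (Ec_nonneg h)

lemma ser_cont (a : ℕ → ℝ) (v : W h hτ hp) (k : ℕ) :
    Continuous (fun x => ((a k : ℝ) : ℂ) * Fb lam (sh k v.1) x) := by
  obtain ⟨v, ⟨c, hb⟩, hf⟩ := v
  exact continuous_const.mul (Fb_cont_sh h hτ.le hb k)

lemma ser_summable {a : ℕ → ℝ} (ha : Summable fun k => |a k| * Ec lam τ ^ k) (v : W h hτ hp) (x : ℝ) :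
    Summable fun k => ((a k : ℝ) : ℂ) * Fb lam (sh k v.1) x := by
  obtain ⟨v, ⟨c, hb⟩, hf⟩ := v
  refine Summable.of_norm_bounded (ha.mul_left (c * Real.exp (τ * |x|))) fun k => ?_
  rw [norm_mul, Complex.norm_real, Real.norm_eq_abs]
  have h1 := Fb_bound h hτ.le (hb.sh k) x
  have h2 : τ ^ (2 * k) ≤ Ec lam τ ^ k := by
    rw [pow_mul]; exact pow_le_pow_left₀ (by positivity) (Ec_ge h) k
  have hc := hb.c_nonneg
  calc _ ≤ |a k| * (c * Ec lam τ ^ k * Real.exp (τ * |x|)) := by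
        refine mul_le_mul_of_nonneg_left (h1.trans ?_) (abs_nonneg _)
        gcongr
    _ = _ := by ring

lemma ser_norm {a : ℕ → ℝ} (N : ℕ) (ha : Summable fun k => |a k| * Ec lam τ ^ k) (v : W h hτ hp) :
    eLpNorm (fun x => ∑' k, ((a (k + N) : ℝ) : ℂ) * Fb lam (sh (k + N) v.1) x) p (μw lam) ≤
      ENNReal.ofReal ((∑' k, |a (k + N)| * Ec lam τ ^ (k + N)) * NW h hτ hp v) := by
  have ha' : Summable fun k => |a (k + N)| * Ec lam τ ^ (k + N) :=
    (summable_nat_add_iff (f := fun k => |a k| * Ec lam τ ^ k) N).2 ha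
  have h0 : 0 ≤ NW h hτ hp v := apply_nonneg _ _
  have hE := Ec_nonneg h (τ := τ)
  rw [← tsum_mul_right]
  refine tsum_norm hp (fun k => ser_cont h hτ hp a v (k + N)) (Filter.Eventually.of_forall fun x => ?_)
    (fun k => by positivity) (ha'.mul_right _) fun k => ?_
  · exact (summable_nat_add_iff (f := fun k => ((a k : ℝ) : ℂ) * Fb lam (sh k v.1) x) N).2
      (ser_summable h hτ hp ha v x)
  · show eLpNorm (((a (k + N) : ℝ) : ℂ) • Fb lam (sh (k + N) v.1)) p (μw lam) ≤ _
    rw [eLpNorm_const_smul, ← shW_pow h hτ hp, NW_of, ← ofReal_norm, Complex.norm_real,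
      Real.norm_eq_abs, ← ENNReal.ofReal_mul (abs_nonneg _)]
    apply ENNReal.ofReal_le_ofReal
    rw [mul_assoc]
    exact mul_le_mul_of_nonneg_left (NW_shk h hτ hp _ v) (abs_nonneg _)

lemma ser_part (a : ℕ → ℝ) (N : ℕ) (v : W h hτ hp) :
    Fb lam (∑ k ∈ Finset.range N, ((a k : ℝ) : ℂ) • (shW h hτ hp ^ k) v : W h hτ hp).1 =
      fun x => ∑ k ∈ Finset.range N, ((a k : ℝ) : ℂ) * Fb lam (sh k v.1) x := by
  induction N with
  | zero => funext x; simp [Fb]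
  | succ N ih =>
    rw [Finset.sum_range_succ]
    set w := (∑ k ∈ Finset.range N, ((a k : ℝ) : ℂ) • (shW h hτ hp ^ k) v : W h hτ hp)
    set w' := ((a N : ℝ) : ℂ) • (shW h hτ hp ^ N) v with hw'
    obtain ⟨⟨c, hc⟩, -⟩ := w.2
    obtain ⟨⟨c', hc'⟩, -⟩ := w'.2
    rw [Submodule.coe_add, Fb_add h hτ hc hc', ih, hw', Submodule.coe_smul, Fb_smul, shW_pow]
    funext x
    rw [Finset.sum_range_succ]
    rfl

lemma ser_partial {a : ℕ → ℝ} (N : ℕ) (ha : Summable fun k => |a k| * Ec lam τ ^ k) (v : W h hτ hp) :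
    NW h hτ hp (∑ k ∈ Finset.range N, ((a k : ℝ) : ℂ) • (shW h hτ hp ^ k) v) ≤
      (eLpNorm (fun x => ∑' k, ((a k : ℝ) : ℂ) * Fb lam (sh k v.1) x) p (μw lam)).toReal +
      (∑' k, |a (k + N)| * Ec lam τ ^ (k + N)) * NW h hτ hp v := by
  have h0 : 0 ≤ NW h hτ hp v := apply_nonneg _ _
  have hE := Ec_nonneg h (τ := τ)
  have hts : 0 ≤ (∑' k, |a (k + N)| * Ec lam τ ^ (k + N)) := tsum_nonneg fun k => by positivity
  have e := ser_part h hτ hp a N v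
  have e2 : (fun x => ∑ k ∈ Finset.range N, ((a k : ℝ) : ℂ) * Fb lam (sh k v.1) x) =
      (fun x => ∑' k, ((a k : ℝ) : ℂ) * Fb lam (sh k v.1) x) -
      (fun x => ∑' k, ((a (k + N) : ℝ) : ℂ) * Fb lam (sh (k + N) v.1) x) := by
    funext x
    have hS := ser_summable h hτ hp ha v x
    rw [Pi.sub_apply, ← hS.sum_add_tsum_nat_add N]
    ring
  have m1 : Measurable (fun x => ∑' k, ((a k : ℝ) : ℂ) * Fb lam (sh k v.1) x) :=
    meas_tsum (fun k => ser_cont h hτ hp a v k) (ser_summable h hτ hp ha v)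
  have m2 : Measurable (fun x => ∑' k, ((a (k + N) : ℝ) : ℂ) * Fb lam (sh (k + N) v.1) x) :=
    meas_tsum (fun k => ser_cont h hτ hp a v (k + N)) fun x =>
      (summable_nat_add_iff (f := fun k => ((a k : ℝ) : ℂ) * Fb lam (sh k v.1) x) N).2
      (ser_summable h hτ hp ha v x)
  have f1 := (ser_norm h hτ hp 0 ha v).trans_lt ENNReal.ofReal_lt_top
  simp only [add_zero] at f1
  rw [NW_def, e, e2]
  refine ENNReal.toReal_le_of_le_ofReal (add_nonneg ENNReal.toReal_nonneg (mul_nonneg hts h0)) ?_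
  rw [ENNReal.ofReal_add ENNReal.toReal_nonneg (mul_nonneg hts h0), ENNReal.ofReal_toReal f1.ne]
  exact (eLpNorm_sub_le m1.aestronglyMeasurable m2.aestronglyMeasurable hp).trans
    (add_le_add le_rfl (ser_norm h hτ hp N ha v))

end Wsec

/-- the universal bound -/
def Mc (lam : ℝ) : ℝ := Ec lam (Real.exp 1 * (2 * lam + 2))

lemma dser_summable {lam : ℝ} (h : -(1/2 : ℝ) < lam) {y : ℝ} (hy : 0 ≤ y) :
    Summable fun k : ℕ => y ^ k / dd lam (2 * k) := by
  refine Summable.of_nonneg_of_le (fun k => ?_) (fun k => ?_) (Real.summable_pow_div_factorial y)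
  · have := dd_pos h (2 * k); positivity
  · have h1 : ((k.factorial : ℕ) : ℝ) ≤ dd lam (2 * k) :=
      le_trans (by exact_mod_cast Nat.factorial_le (by omega)) (dd_ge h (2 * k))
    gcongr

/-- remainders -/
def Rr (lam r : ℝ) (N : ℕ) : ℝ := ∑' k : ℕ, (Mc lam * r) ^ (k + N) / dd lam (2 * (k + N))

lemma Mc_nonneg {lam : ℝ} (h : -(1/2 : ℝ) < lam) : 0 ≤ Mc lam := Ec_nonneg h

lemma Rr_nonneg {lam : ℝ} (h : -(1/2 : ℝ) < lam) (r : ℝ) (N : ℕ) (hr : 0 ≤ r) : 0 ≤ Rr lam r N :=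
  tsum_nonneg fun k => by
    have := dd_pos h (2 * (k + N)); have := Mc_nonneg h; positivity

lemma Rr_tendsto {lam : ℝ} (r : ℝ) :
    Filter.Tendsto (Rr lam r) Filter.atTop (nhds 0) :=
  tendsto_sum_nat_add (fun k : ℕ => (Mc lam * r) ^ k / dd lam (2 * k))

open Polynomial in
/-- admissible seminorms -/
def GG (lam : ℝ) : Set (Seminorm ℂ ℂ[X]) := {n | (∀ Q, n (X * Q) ≤ Mc lam * n Q) ∧
  ∀ r : ℝ, 0 ≤ r → ∀ N : ℕ, ∀ Q, n ((∑ k ∈ Finset.range N, (((-1) ^ k * r ^ k / dd lam (2 * k) : ℝ) : ℂ) • X ^ k) * Q)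
    ≤ (2 + Rr lam r N) * n Q}

open Polynomial in
lemma GG_ne {lam : ℝ} (h : -(1/2 : ℝ) < lam) (P : ℂ[X]) : (MB (GG lam) P).Nonempty := by
  have hX : ∀ (k : ℕ), ∀ n ∈ GG lam, ∀ Q, n (X ^ k * Q) ≤ Mc lam ^ k * n Q := by
    intro k n hn
    induction k with
    | zero => intro Q; simp
    | succ k ih =>
      intro Q
      rw [pow_succ, mul_assoc, pow_succ, mul_assoc]
      exact (ih _).trans (mul_le_mul_of_nonneg_left (hn.1 Q) (pow_nonneg (Mc_nonneg h) _))
  induction P using Polynomial.induction_on' with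
  | add p q hp hq =>
    obtain ⟨A, hA⟩ := hp
    obtain ⟨B, hB⟩ := hq
    refine ⟨A + B, add_nonneg hA.1 hB.1, fun n hn Q => ?_⟩
    rw [add_mul, add_mul]
    exact (map_add_le_add n _ _).trans (add_le_add (hA.2 n hn Q) (hB.2 n hn Q))
  | monomial k a =>
    refine ⟨‖a‖ * Mc lam ^ k, mul_nonneg (norm_nonneg _) (pow_nonneg (Mc_nonneg h) _), fun n hn Q => ?_⟩
    rw [← C_mul_X_pow_eq_monomial, ← smul_eq_C_mul, smul_mul_assoc, map_smul_eq_mul, mul_assoc]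
    exact mul_le_mul_of_nonneg_left (hX k n hn Q) (norm_nonneg _)

open Polynomial in
theorem GG_core {lam : ℝ} (h : -(1/2 : ℝ) < lam) (m : ℕ) : ∃ K : ℝ, 0 ≤ K ∧ ∃ N₁, ∀ N ≥ N₁, ∀ n ∈ GG lam,
    n 1 ≤ K * n (∑ k ∈ Finset.range N, ((psi lam m k : ℝ) : ℂ) • X ^ k) :=
  core2 h (GG_ne h) X (Mc_nonneg h) (fun n hn => hn.1) (Rr lam) (fun r N hr => Rr_nonneg h r N hr)
    (fun r _ => Rr_tendsto r) (fun r hr N n hn Q => hn.2 r hr N Q) (psi lam m)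
    (psi_summable h m _ (Mc_nonneg h)) (fun y hy => psi_ne h m hy)

section conc
variable {lam : ℝ} (h : -(1/2 : ℝ) < lam) {τ : ℝ} (hτ : 0 < τ) {p : ℝ≥0∞} (hp : 1 ≤ p)

/-- the operator `-t² Λ²` -/
def Dt (t : ℝ) : Module.End ℂ (W h hτ hp) := (((-t ^ 2 : ℝ)) : ℂ) • shW h hτ hp

/-- the concrete seminorm -/
def nG (t : ℝ) (g : W h hτ hp) : Seminorm ℂ (Polynomial ℂ) :=
  (NW h hτ hp).comp ((LinearMap.applyₗ g).comp (Polynomial.aeval (Dt h hτ hp t)).toLinearMap)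

lemma nG_def (t : ℝ) (g : W h hτ hp) (P : Polynomial ℂ) :
    nG h hτ hp t g P = NW h hτ hp (Polynomial.aeval (Dt h hτ hp t) P g) := rfl

lemma aeval_Dt (t : ℝ) (a : ℕ → ℝ) (N : ℕ) (v : W h hτ hp) :
    Polynomial.aeval (Dt h hτ hp t) (∑ k ∈ Finset.range N, ((a k : ℝ) : ℂ) • (Polynomial.X : Polynomial ℂ) ^ k) v =
    ∑ k ∈ Finset.range N, ((a k * (-t ^ 2) ^ k : ℝ) : ℂ) • (shW h hτ hp ^ k) v := by
  rw [map_sum, LinearMap.sum_apply]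
  refine Finset.sum_congr rfl fun k _ => ?_
  rw [map_smul, map_pow, Polynomial.aeval_X, Dt, smul_pow, smul_smul, LinearMap.smul_apply]
  congr 1
  push_cast; ring

lemma Ec_mul {t : ℝ} (ht : 0 ≤ t) (hle : t * τ ≤ Real.exp 1 * (2 * lam + 2)) (h : -(1/2 : ℝ) < lam)
    (hτ : 0 < τ) : t ^ 2 * Ec lam τ ≤ Mc lam := by
  have := dd_pos h 2
  unfold Mc Ec
  calc _ = 2 * Real.exp 1 * dd lam 2 * (t * τ) ^ 2 := by ring
    _ ≤ _ := by gcongr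

lemma nG_mem {t : ℝ} (ht : 0 ≤ t) (hle : t * τ ≤ Real.exp 1 * (2 * lam + 2)) (g : W h hτ hp) :
    nG h hτ hp t g ∈ GG lam := by
  have hE := Ec_mul ht hle h hτ
  have hE0 := Ec_nonneg h (τ := τ)
  refine ⟨fun Q => ?_, fun r hr N Q => ?_⟩
  · rw [nG_def, nG_def, map_mul, Polynomial.aeval_X, Module.End.mul_apply]
    set v := Polynomial.aeval (Dt h hτ hp t) Q g
    rw [Dt, LinearMap.smul_apply, map_smul_eq_mul, Complex.norm_real, norm_neg, norm_pow,
      Real.norm_of_nonneg ht]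
    have h0 : 0 ≤ NW h hτ hp v := apply_nonneg _ _
    calc _ ≤ t ^ 2 * (Ec lam τ * NW h hτ hp v) :=
          mul_le_mul_of_nonneg_left (NW_sh h hτ hp v) (sq_nonneg t)
      _ = (t ^ 2 * Ec lam τ) * NW h hτ hp v := by ring
      _ ≤ _ := mul_le_mul_of_nonneg_right hE h0
  · rw [nG_def, nG_def, map_mul, Module.End.mul_apply]
    set v := Polynomial.aeval (Dt h hτ hp t) Q g
    have h0 : 0 ≤ NW h hτ hp v := apply_nonneg _ _
    rw [aeval_Dt]
    set s := Real.sqrt r * t with hs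
    have hs2 : s ^ 2 = r * t ^ 2 := by rw [hs, mul_pow, Real.sq_sqrt hr]
    have ea : ∀ k : ℕ, (-1 : ℝ) ^ k * r ^ k / dd lam (2 * k) * (-t ^ 2) ^ k = s ^ (2 * k) / dd lam (2 * k) := by
      intro k
      rw [pow_mul, hs2, mul_pow, neg_pow (t ^ 2) k]
      have : (-1 : ℝ) ^ k * (-1) ^ k = 1 := by rw [← mul_pow]; simp
      linear_combination (r ^ k * (t ^ 2) ^ k / dd lam (2 * k)) * this
    simp_rw [ea]
    have eb : ∀ k : ℕ, |s ^ (2 * k) / dd lam (2 * k)| * Ec lam τ ^ k = (r * (t ^ 2 * Ec lam τ)) ^ k / dd lam (2 * k) := by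
      intro k
      rw [abs_of_nonneg (by have := dd_pos h (2 * k); rw [pow_mul]; positivity), pow_mul, hs2]
      simp only [mul_pow]; ring
    have hy : 0 ≤ r * (t ^ 2 * Ec lam τ) := by positivity
    have hsum : Summable fun k : ℕ => |s ^ (2 * k) / dd lam (2 * k)| * Ec lam τ ^ k := by
      simp_rw [eb]
      exact dser_summable h hy
    refine (ser_partial h hτ hp N hsum v).trans ?_
    rw [add_mul]
    refine add_le_add ?_ (mul_le_mul_of_nonneg_right ?_ h0)
    · obtain ⟨⟨c, hc⟩, hf⟩ := v.2
      have := Ts_norm h hτ.le hc s hp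
      have := ENNReal.toReal_mono (ENNReal.mul_ne_top (by simp) hf) this
      rw [ENNReal.toReal_mul] at this
      exact this
    · simp_rw [eb]
      unfold Rr
      have hM := Mc_nonneg h
      have hle2 : r * (t ^ 2 * Ec lam τ) ≤ Mc lam * r := by
        rw [mul_comm (Mc lam)]; exact mul_le_mul_of_nonneg_left hE hr
      refine Summable.tsum_le_tsum (fun k => ?_)
        ((summable_nat_add_iff (f := fun k => (r * (t ^ 2 * Ec lam τ)) ^ k / dd lam (2 * k)) N).2 (dser_summable h hy))
        ((summable_nat_add_iff (f := fun k => (Mc lam * r) ^ k / dd lam (2 * k)) N).2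
          (dser_summable h (mul_nonneg hM hr)))
      have := dd_pos h (2 * (k + N))
      gcongr

/-- the normalised difference -/
def St (lam : ℝ) (m : ℕ) (t : ℝ) (g : ℕ → ℂ) (x : ℝ) : ℂ :=
  ∑' k, ((psi lam m k * (-t ^ 2) ^ k : ℝ) : ℂ) * Fb lam (sh k g) x

lemma psi_sum_t {t : ℝ} (ht : 0 ≤ t) (hle : t * τ ≤ Real.exp 1 * (2 * lam + 2)) (h : -(1/2 : ℝ) < lam)
    (hτ : 0 < τ) (m : ℕ) :
    (∀ k, |psi lam m k * (-t ^ 2) ^ k| * Ec lam τ ^ k ≤ |psi lam m k| * Mc lam ^ k) ∧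
    Summable (fun k => |psi lam m k * (-t ^ 2) ^ k| * Ec lam τ ^ k) := by
  have hE := Ec_mul ht hle h hτ
  have hE0 := Ec_nonneg h (τ := τ)
  have h1 : ∀ k, |psi lam m k * (-t ^ 2) ^ k| * Ec lam τ ^ k ≤ |psi lam m k| * Mc lam ^ k := by
    intro k
    rw [abs_mul, abs_pow, abs_neg, abs_of_nonneg (sq_nonneg t), mul_assoc, ← mul_pow]
    gcongr
  exact ⟨h1, Summable.of_nonneg_of_le (fun k => by positivity) h1 (psi_summable h m _ (Mc_nonneg h))⟩

lemma St_upper {t : ℝ} (ht : 0 ≤ t) (hle : t * τ ≤ Real.exp 1 * (2 * lam + 2)) (m : ℕ) (g : W h hτ hp) :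
    eLpNorm (St lam m t g.1) p (μw lam) ≤
      ENNReal.ofReal ((∑' k, |psi lam m k| * Mc lam ^ k) * NW h hτ hp g) := by
  obtain ⟨h1, h2⟩ := psi_sum_t ht hle h hτ m
  have := ser_norm h hτ hp 0 h2 g
  simp only [add_zero] at this
  refine this.trans (ENNReal.ofReal_le_ofReal ?_)
  exact mul_le_mul_of_nonneg_right (h2.tsum_le_tsum h1 (psi_summable h m _ (Mc_nonneg h))) (apply_nonneg _ _)

lemma St_lower {K : ℝ} (hK : 0 ≤ K) (m : ℕ)
    (hKN : ∃ N₁, ∀ N ≥ N₁, ∀ n ∈ GG lam,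
    n 1 ≤ K * n (∑ k ∈ Finset.range N, ((psi lam m k : ℝ) : ℂ) • (Polynomial.X : Polynomial ℂ) ^ k))
    {t : ℝ} (ht : 0 ≤ t) (hle : t * τ ≤ Real.exp 1 * (2 * lam + 2)) (g : W h hτ hp) :
    NW h hτ hp g ≤ K * (eLpNorm (St lam m t g.1) p (μw lam)).toReal := by
  obtain ⟨N₁, hN⟩ := hKN
  obtain ⟨h1, h2⟩ := psi_sum_t ht hle h hτ m
  have l : Filter.Tendsto (fun N => K * ((eLpNorm (St lam m t g.1) p (μw lam)).toReal +
      (∑' k, |psi lam m (k + N) * (-t ^ 2) ^ (k + N)| * Ec lam τ ^ (k + N)) * NW h hτ hp g)) Filter.atTop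
      (nhds (K * ((eLpNorm (St lam m t g.1) p (μw lam)).toReal + 0 * NW h hτ hp g))) :=
    (((tendsto_sum_nat_add (fun k => |psi lam m k * (-t ^ 2) ^ k| * Ec lam τ ^ k)).mul_const _).const_add _).const_mul K
  rw [zero_mul, add_zero] at l
  refine ge_of_tendsto l ?_
  filter_upwards [Filter.eventually_ge_atTop N₁] with N hN1
  have := hN N hN1 _ (nG_mem h hτ hp ht hle g)
  rw [nG_def, nG_def, map_one, aeval_Dt] at this
  refine this.trans (mul_le_mul_of_nonneg_left ?_ hK)
  exact ser_partial h hτ hp N h2 g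

end conc

lemma symmDiff_eq {lam : ℝ} (h : -(1/2 : ℝ) < lam) {c τ : ℝ} (hτ : 0 ≤ τ) {b : ℕ → ℂ}
    (hb : Bd c τ b) (m : ℕ) (t : ℝ) :
    symmDiff lam m t (Fb lam b) =
      ((((Nat.choose (2 * m) m : ℝ)⁻¹ * (clam lam * kap lam)) * t ^ (2 * m) : ℝ) : ℂ) • St lam m t (sh m b) := by
  funext x
  set Y : ℤ → ℂ := fun s => ∑' k, ((((s:ℝ) * t) ^ (2 * k) / dd lam (2 * k) : ℝ) : ℂ) * Fb lam (sh k b) x with hY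
  have hTs : ∀ s : ℤ, T lam ((s:ℝ) * t) (Fb lam b) x = ((clam lam * kap lam : ℝ) : ℂ) * Y s :=
    fun s => (T_sum h hτ hb ((s:ℝ) * t) x).2
  have hHS : ∀ s ∈ Finset.Icc (-(m : ℤ)) (m : ℤ), HasSum (fun k => ((cs m s : ℝ) : ℂ) * (((((s:ℝ) * t) ^ (2 * k) / dd lam (2 * k) : ℝ) : ℂ) * Fb lam (sh k b) x))
      (((cs m s : ℝ) : ℂ) * Y s) := fun s _ => (T_sum h hτ hb ((s:ℝ) * t) x).1.hasSum.mul_left _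
  have hS := hasSum_sum hHS
  have hS2 : HasSum (fun k => ((wt m k * (t ^ (2 * k) / dd lam (2 * k)) : ℝ) : ℂ) * Fb lam (sh k b) x)
      (∑ s ∈ Finset.Icc (-(m : ℤ)) (m : ℤ), ((cs m s : ℝ) : ℂ) * Y s) := by
    refine hs_congr (fun k => ?_) hS
    rw [wt, Finset.sum_mul]
    push_cast
    rw [Finset.sum_mul]
    refine Finset.sum_congr rfl fun s _ => ?_
    rw [mul_pow]; ring
  have e1 := hS2.summable.sum_add_tsum_nat_add m
  rw [hS2.tsum_eq, Finset.sum_eq_zero (fun k hk => by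
    rw [wt_lt (Finset.mem_range.1 hk)]; simp), zero_add] at e1
  have e2 : ∀ k, ((wt m (k + m) * (t ^ (2 * (k + m)) / dd lam (2 * (k + m))) : ℝ) : ℂ) * Fb lam (sh (k + m) b) x =
      ((t ^ (2 * m) : ℝ) : ℂ) * (((psi lam m k * (-t ^ 2) ^ k : ℝ) : ℂ) * Fb lam (sh k (sh m b)) x) := by
    intro k
    have : sh (k + m) b = sh k (sh m b) := by
      funext n; show b _ = b _; congr 1; ring
    rw [this, ← mul_assoc, ← Complex.ofReal_mul]
    congr 2
    rw [psi, neg_pow (t ^ 2) k]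
    have h1 : (-1 : ℝ) ^ k * (-1) ^ k = 1 := by rw [← mul_pow]; simp
    have h2 : t ^ (2 * (k + m)) = t ^ (2 * m) * (t ^ 2) ^ k := by rw [← pow_mul, ← pow_add]; congr 1; ring
    rw [h2]
    linear_combination (-(wt m (k + m) * (t ^ (2 * m) * (t ^ 2) ^ k) / dd lam (2 * (k + m)))) * h1
  simp_rw [e2] at e1
  rw [tsum_mul_left] at e1
  unfold symmDiff
  rw [Pi.smul_apply, smul_eq_mul]
  have e3 : ∑ s ∈ Finset.Icc (-(m : ℤ)) (m : ℤ),
      (-1 : ℂ) ^ s * (Nat.choose (2 * m) ((m : ℤ) - s).toNat : ℂ) * T lam ((s : ℝ) * t) (Fb lam b) x =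
      ((clam lam * kap lam : ℝ) : ℂ) * ∑ s ∈ Finset.Icc (-(m : ℤ)) (m : ℤ), ((cs m s : ℝ) : ℂ) * Y s := by
    rw [Finset.mul_sum]
    refine Finset.sum_congr rfl fun s _ => ?_
    rw [hTs, cs]; push_cast; ring
  rw [e3, ← e1]
  unfold St
  push_cast; ring

lemma coeffs {lam : ℝ} (h : -(1/2 : ℝ) < lam) {σ : ℝ} (hσ : 0 < σ) {f : ℂ → ℂ} (hf : IsExpType σ f) :
    ∃ c b, Bd c (2 * Real.exp 1 * (2 * lam + 2) * σ) b ∧ (fun x : ℝ => f (x : ℂ)) = Fb lam b := by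
  obtain ⟨ha, hg⟩ := hf
  obtain ⟨c, hc⟩ := hg σ hσ
  have hd : Differentiable ℂ f := fun z => (ha z (Set.mem_univ z)).differentiableAt
  have hc0 : 0 ≤ c := by
    have := (norm_nonneg _).trans (hc 0); simpa using this
  have hD : ∀ n : ℕ, ‖iteratedDeriv n f 0‖ ≤ c * (2 * Real.exp 1 * σ) ^ n := by
    intro n
    rcases Nat.eq_zero_or_pos n with rfl | hn
    · simpa using hc 0
    · have hn' : (0:ℝ) < n := by exact_mod_cast hn
      set R : ℝ := n / (2 * σ) with hR
      have hR0 : 0 < R := by positivity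
      have := Complex.norm_iteratedDeriv_le_of_forall_mem_sphere_norm_le (f := f) (c := 0) (R := R)
        (C := c * Real.exp ((σ + σ) * R)) n hR0 hd.diffContOnCl (fun z hz => by
          have hz : ‖z‖ = R := by simpa using hz
          have := hc z; rwa [hz] at this)
      refine this.trans ?_
      have e : (σ + σ) * R = n := by rw [hR]; field_simp; ring
      rw [e]
      have hf : (n.factorial : ℝ) ≤ (n:ℝ) ^ n := by exact_mod_cast Nat.factorial_le_pow n
      have e2 : Real.exp n = Real.exp 1 ^ n := by rw [← Real.exp_nat_mul, mul_one]
      rw [hR, e2, div_pow, mul_pow, mul_pow, mul_pow]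
      rw [div_le_iff₀ (by positivity)]
      have : c * (2 ^ n * Real.exp 1 ^ n * σ ^ n) * ((n:ℝ) ^ n / (2 ^ n * σ ^ n)) = (n:ℝ) ^ n * (c * Real.exp 1 ^ n) := by
        field_simp
      rw [this]
      gcongr
  refine ⟨c, fun n => ((dd lam n / n.factorial : ℝ) : ℂ) * iteratedDeriv n f 0, fun n => ?_, ?_⟩
  · have hdn := dd_pos h n
    rw [norm_mul, Complex.norm_real, Real.norm_of_nonneg (by positivity)]
    have h1 : dd lam n / n.factorial ≤ (2 * lam + 2) ^ n := by
      rw [div_le_iff₀ (by positivity), mul_comm]; exact dd_le h n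
    have h2 : 0 ≤ 2 * lam + 2 := by linarith
    calc _ ≤ (2 * lam + 2) ^ n * (c * (2 * Real.exp 1 * σ) ^ n) :=
          mul_le_mul h1 (hD n) (norm_nonneg _) (by positivity)
      _ = _ := by simp only [mul_pow]; ring
  · funext x
    have := Complex.hasSum_taylorSeries_of_entire hd 0 (x:ℂ)
    rw [← this.tsum_eq]
    unfold Fb
    refine tsum_congr fun n => ?_
    have hdn : ((dd lam n : ℝ) : ℂ) ≠ 0 := by exact_mod_cast (dd_pos h n).ne'
    have hfn : ((n.factorial : ℕ) : ℂ) ≠ 0 := by exact_mod_cast n.factorial_ne_zero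
    push_cast
    simp only [smul_eq_mul, sub_zero]
    field_simp

theorem boas (lam : ℝ) (hlam : -(1/2 : ℝ) < lam) (m : ℕ) :
    ∃ C : ℝ, 0 < C ∧ ∀ σ : ℝ, 0 < σ → ∀ p : ℝ≥0∞, 1 ≤ p →
      ∀ f : ℂ → ℂ, IsExpType σ f →
        eLpNorm (fun x : ℝ => f (x : ℂ)) p (μw lam) < ⊤ →
        ∀ δ t : ℝ, 0 < δ → δ ≤ t → t ≤ 1 / (2 * σ) →
        ENNReal.ofReal (1 / δ ^ (2 * m)) *
            eLpNorm (symmDiff lam m δ fun x : ℝ => f (x : ℂ)) p (μw lam) ≤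
          ENNReal.ofReal (C / t ^ (2 * m)) *
            eLpNorm (symmDiff lam m t fun x : ℝ => f (x : ℂ)) p (μw lam) := by
  obtain ⟨K, hK0, hK⟩ := GG_core hlam m
  have hM := Mc_nonneg hlam
  set A : ℝ := ∑' k, |psi lam m k| * Mc lam ^ k with hA
  have hA0 : 0 ≤ A := tsum_nonneg fun k => by positivity
  refine ⟨A * K + 1, by positivity, fun σ hσ p hp f hf hfin δ t hδ hδt ht => ?_⟩
  have ht0 : 0 < t := hδ.trans_le hδt
  have h2 : 0 < 2 * lam + 2 := by linarith
  obtain ⟨c, b, hb, hfb⟩ := coeffs hlam hσ hf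
  set τ : ℝ := 2 * Real.exp 1 * (2 * lam + 2) * σ with hτd
  have hτ : 0 < τ := by positivity
  have hle : t * τ ≤ Real.exp 1 * (2 * lam + 2) := by
    have : t * (2 * σ) ≤ 1 := by rwa [le_div_iff₀ (by positivity)] at ht
    calc t * τ = (Real.exp 1 * (2 * lam + 2)) * (t * (2 * σ)) := by rw [hτd]; ring
      _ ≤ (Real.exp 1 * (2 * lam + 2)) * 1 := by gcongr
      _ = _ := mul_one _
  have hle' : δ * τ ≤ Real.exp 1 * (2 * lam + 2) := le_trans (by gcongr) hle
  rw [hfb] at hfin ⊢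
  let b0 : W hlam hτ hp := ⟨b, ⟨c, hb⟩, hfin.ne⟩
  set g := (shW hlam hτ hp ^ m) b0 with hg
  have hgv : g.1 = sh m b := shW_pow hlam hτ hp m b0
  have hκ : 0 < ((Nat.choose (2 * m) m : ℝ)⁻¹ * (clam lam * kap lam)) := by
    have := clam_pos hlam
    have := kap_pos hlam
    have : (0:ℝ) < Nat.choose (2 * m) m := by exact_mod_cast Nat.choose_pos (by omega)
    positivity
  set κ := ((Nat.choose (2 * m) m : ℝ)⁻¹ * (clam lam * kap lam))
  have hsd : ∀ s : ℝ, 0 < s → ∀ c' : ℝ, 0 ≤ c' → ENNReal.ofReal (c' / s ^ (2 * m)) * eLpNorm (symmDiff lam m s (Fb lam b)) p (μw lam) =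
      ENNReal.ofReal (κ * c') * eLpNorm (St lam m s g.1) p (μw lam) := by
    intro s hs c' hc'
    rw [symmDiff_eq hlam hτ.le hb, eLpNorm_const_smul, ← ofReal_norm, Complex.norm_real,
      Real.norm_of_nonneg (by positivity), ← mul_assoc, ← ENNReal.ofReal_mul (by positivity), hgv]
    congr 2
    field_simp
    try ring
  rw [hsd δ hδ 1 zero_le_one, hsd t ht0 (A * K + 1) (by positivity), mul_one,
    ENNReal.ofReal_mul hκ.le, mul_assoc]
  refine mul_le_mul_right ?_ _
  have u1 := St_upper hlam hτ hp hδ.le hle' m g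
  have u2 := (St_upper hlam hτ hp ht0.le hle m g).trans_lt ENNReal.ofReal_lt_top
  have l1 := St_lower hlam hτ hp hK0 m hK ht0.le hle g
  refine u1.trans ?_
  rw [← ENNReal.ofReal_toReal u2.ne, ← ENNReal.ofReal_mul (by positivity)]
  apply ENNReal.ofReal_le_ofReal
  have h0 : 0 ≤ (eLpNorm (St lam m t g.1) p (μw lam)).toReal := ENNReal.toReal_nonneg
  calc _ ≤ A * (K * (eLpNorm (St lam m t g.1) p (μw lam)).toReal) := mul_le_mul_of_nonneg_left l1 hA0
    _ ≤ _ := by nlinarith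

/-- Boas-type inequality: for `λ > −1/2` and `m ∈ ℕ` there is a constant `C`,
depending only on `λ` and `m`, such that for every `σ > 0`, `1 ≤ p ≤ ∞`, every entire function
`f` of exponential type at most `σ` with finite `L^p(ℝ,dμ)` norm, and all `0 < δ ≤ t ≤ 1/(2σ)`,
`δ^{−2m} ‖**Δ_δ^m f‖_{L^p(ℝ,dμ)} ≤ C t^{−2m} ‖**Δ_t^m f‖_{L^p(ℝ,dμ)}`. -/
theorem stmt15 (lam : ℝ) (hlam : -(1/2 : ℝ) < lam) (m : ℕ) (hm : 0 < m) :
    ∃ C : ℝ, 0 < C ∧ ∀ σ : ℝ, 0 < σ → ∀ p : ℝ≥0∞, 1 ≤ p →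
      ∀ f : ℂ → ℂ, IsExpType σ f →
        eLpNorm (fun x : ℝ => f (x : ℂ)) p (μw lam) < ⊤ →
        ∀ δ t : ℝ, 0 < δ → δ ≤ t → t ≤ 1 / (2 * σ) →
        ENNReal.ofReal (1 / δ ^ (2 * m)) *
            eLpNorm (symmDiff lam m δ fun x : ℝ => f (x : ℂ)) p (μw lam) ≤
          ENNReal.ofReal (C / t ^ (2 * m)) *
            eLpNorm (symmDiff lam m t fun x : ℝ => f (x : ℂ)) p (μw lam) := by
  exact boas lam hlam m

end Dunkl1DStmt15
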